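/- arXiv:1409.6060 — 3 statements merged into one kernel-verified Lean document; each statement's English description precedes it below -/
import Mathlib

section
/- Let n ≥ 2, 0 < s < 1, n > 2s, and σ ∈ (−n, −n+2s). Then for every x ∈ ℝⁿ with |x| > 1, the fractional Laplacian of |x|^σ is negative: (−Δ)^s(|·|^σ)(x) < 0. -/
open MeasureTheory

/-- The fractional Laplacian `(-Δ)^s` (normalization constant `C(n,s) = 1`),
written via second differences. -/
noncomputable def fracLap (n : ℕ) (s : ℝ) (u : EuclideanSpace ℝ (Fin n) → ℝ)
    (x : EuclideanSpace ℝ (Fin n)) : ℝ :=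
  -(1/2 : ℝ) * ∫ y : EuclideanSpace ℝ (Fin n),
    (u (x + y) + u (x - y) - 2 * u x) / ‖y‖ ^ ((n : ℝ) + 2 * s)

section FractionalLaplacianOfPowers

open Filter Metric Module
open scoped Topology

section Inversion

lemma inversion_image_compl_zero {E : Type*} [NormedAddCommGroup E] [InnerProductSpace ℝ E] :
    EuclideanGeometry.inversion (0 : E) 1 '' {0}ᶜ = {0}ᶜ := by
  ext z
  constructor
  · rintro ⟨y, hy, rfl⟩
    simpa [EuclideanGeometry.inversion_eq_center] using hy
  · intro hz
    exact ⟨EuclideanGeometry.inversion 0 1 z,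
      by simpa [EuclideanGeometry.inversion_eq_center] using hz,
      EuclideanGeometry.inversion_inversion 0 one_ne_zero z⟩

variable {E : Type*} [NormedAddCommGroup E] [InnerProductSpace ℝ E] [FiniteDimensional ℝ E]

lemma abs_det_fderiv_inversion (z : E) :
    |((1 / dist z 0) ^ 2 • ((ℝ ∙ (z - 0))ᗮ.reflection : E →L[ℝ] E)).det| =
      (‖z‖ ^ (2 * finrank ℝ E))⁻¹ := by
  have h : LinearMap.det (((ℝ ∙ z)ᗮ.reflection : E →L[ℝ] E) : E →ₗ[ℝ] E) =
      (-1) ^ finrank ℝ (ℝ ∙ z)ᗮᗮ := (ℝ ∙ z)ᗮ.det_reflection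
  rw [ContinuousLinearMap.det, ContinuousLinearMap.toLinearMap_smul, LinearMap.det_smul,
    sub_zero, h]
  simp [abs_mul, abs_pow, pow_mul]

variable [MeasurableSpace E] [BorelSpace E] [Nontrivial E]

lemma restrict_compl_zero : (volume : Measure E).restrict {0}ᶜ = volume :=
  Measure.restrict_eq_self_of_ae_mem (by simp [ae_iff])

lemma integral_comp_inversion (g : E → ℝ) :
    ∫ z, (‖z‖ ^ (2 * finrank ℝ E))⁻¹ * g (EuclideanGeometry.inversion 0 1 z) = ∫ z, g z := by
  have h := integral_image_eq_integral_abs_det_fderiv_smul (volume : Measure E)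
    (measurableSet_singleton (0 : E)).compl
    (fun z hz => (EuclideanGeometry.hasFDerivAt_inversion (c := (0 : E)) (R := 1)
      hz).hasFDerivWithinAt)
    (EuclideanGeometry.inversion_injective (0 : E) one_ne_zero).injOn g
  simpa only [inversion_image_compl_zero, restrict_compl_zero, abs_det_fderiv_inversion,
    smul_eq_mul, eq_comm] using h.symm

lemma integrable_comp_inversion {g : E → ℝ} (hg : Integrable g) :
    Integrable fun z => (‖z‖ ^ (2 * finrank ℝ E))⁻¹ * g (EuclideanGeometry.inversion 0 1 z) := by
  have h := integrableOn_image_iff_integrableOn_abs_det_fderiv_smul (volume : Measure E)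
    (measurableSet_singleton (0 : E)).compl
    (fun z hz => (EuclideanGeometry.hasFDerivAt_inversion (c := (0 : E)) (R := 1)
      hz).hasFDerivWithinAt)
    (EuclideanGeometry.inversion_injective (0 : E) one_ne_zero).injOn g
  simp only [inversion_image_compl_zero, IntegrableOn, restrict_compl_zero,
    abs_det_fderiv_inversion, smul_eq_mul] at h
  exact h.1 hg

end Inversion

section Taylor

lemma one_add_rpow_taylor (α : ℝ) :
    ∃ C : ℝ, ∃ δ > 0, ∀ t : ℝ, |t| < δ → |(1 + t) ^ α - 1 - α * t| ≤ C * t ^ 2 := by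
  have h := (Real.one_add_rpow_hasFPowerSeriesAt_zero (a := α)).isBigO_sub_partialSum_pow 2
  obtain ⟨C, hC⟩ := h.bound
  obtain ⟨δ, hδ, hb⟩ := Metric.eventually_nhds_iff.1 hC
  refine ⟨C, δ, hδ, fun t ht => ?_⟩
  have := hb (y := t) (by simpa using ht)
  simp [FormalMultilinearSeries.partialSum, Finset.sum_range_succ, binomialSeries] at this
  rw [sub_sub]
  convert this using 3
  ring

variable {E : Type*} [NormedAddCommGroup E] [InnerProductSpace ℝ E]

/-- First and second order differences of `‖·‖ ^ σ` at a unit vector. -/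
lemma norm_rpow_differences (σ : ℝ) {e : E} (he : ‖e‖ = 1) :
    ∃ C > 0, ∃ δ > 0, δ ≤ 1 / 2 ∧ ∀ y : E, ‖y‖ < δ →
      |‖e + y‖ ^ σ - 1| ≤ C * ‖y‖ ∧ |‖e - y‖ ^ σ - 1| ≤ C * ‖y‖ ∧
      |‖e + y‖ ^ σ + ‖e - y‖ ^ σ - 2| ≤ C * ‖y‖ ^ 2 := by
  obtain ⟨C, δ, hδ, hC⟩ := one_add_rpow_taylor (σ / 2)
  refine ⟨18 * |C| + 3 * |σ| + 1, by positivity, min (δ / 3) (1 / 2), by positivity,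
    min_le_right _ _, fun y hy => ?_⟩
  have hy1 : ‖y‖ < δ / 3 := hy.trans_le (min_le_left _ _)
  have hy2 : ‖y‖ < 1 / 2 := hy.trans_le (min_le_right _ _)
  have hy0 := norm_nonneg y
  have key : ∀ v : E, ‖v‖ = ‖y‖ → ∃ r : ℝ, |r| ≤ 9 * |C| * ‖y‖ ^ 2 ∧
      ‖e + v‖ ^ σ = 1 + σ / 2 * (2 * inner ℝ e v + ‖y‖ ^ 2) + r ∧ |inner ℝ e v| ≤ ‖y‖ := by
    intro v hv
    have hin : |inner ℝ e v| ≤ ‖y‖ := by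
      simpa [he, hv] using abs_real_inner_le_norm e v
    have ht : |2 * inner ℝ e v + ‖y‖ ^ 2| ≤ 3 * ‖y‖ := by
      rw [abs_le] at hin ⊢
      constructor <;> nlinarith
    refine ⟨_, ?_, (add_sub_cancel _ _).symm, hin⟩
    have hsq : ‖e + v‖ ^ σ = (1 + (2 * inner ℝ e v + ‖y‖ ^ 2)) ^ (σ / 2) := by
      have : ‖e + v‖ ^ 2 = 1 + (2 * inner ℝ e v + ‖y‖ ^ 2) := by
        rw [norm_add_sq_real, he, hv]; ring
      rw [← this, ← Real.rpow_natCast, ← Real.rpow_mul (norm_nonneg _)]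
      congr 1; push_cast; ring
    rw [hsq, ← sub_sub]
    refine (hC _ (by linarith)).trans ?_
    calc C * (2 * inner ℝ e v + ‖y‖ ^ 2) ^ 2 ≤ |C| * (3 * ‖y‖) ^ 2 := by
          exact mul_le_mul (le_abs_self C) (sq_le_sq' (abs_le.1 ht).1 (abs_le.1 ht).2)
            (sq_nonneg _) (abs_nonneg C)
      _ = _ := by ring
  obtain ⟨r₁, hr₁, h₁, hi₁⟩ := key y rfl
  obtain ⟨r₂, hr₂, h₂, hi₂⟩ := key (-y) (norm_neg y)
  rw [← sub_eq_add_neg, inner_neg_right] at h₂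
  rw [inner_neg_right] at hi₂
  have hsq : ‖y‖ ^ 2 ≤ ‖y‖ := by nlinarith
  have hlin : ∀ i r : ℝ, |i| ≤ ‖y‖ → |r| ≤ 9 * |C| * ‖y‖ ^ 2 →
      |1 + σ / 2 * (2 * i + ‖y‖ ^ 2) + r - 1| ≤ (18 * |C| + 3 * |σ| + 1) * ‖y‖ := by
    intro i r hi hr
    have h1 : |1 + σ / 2 * (2 * i + ‖y‖ ^ 2) + r - 1| ≤
        |σ| / 2 * (2 * |i| + ‖y‖ ^ 2) + |r| := by
      have e1 : 1 + σ / 2 * (2 * i + ‖y‖ ^ 2) + r - 1 = σ / 2 * (2 * i + ‖y‖ ^ 2) + r := by ring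
      rw [e1]
      refine (abs_add_le _ _).trans ?_
      rw [abs_mul, abs_div, abs_two]
      gcongr
      refine (abs_add_le _ _).trans ?_
      rw [abs_mul, abs_two, abs_of_nonneg (sq_nonneg ‖y‖)]
    have h2 : |σ| / 2 * (2 * |i| + ‖y‖ ^ 2) ≤ |σ| / 2 * (3 * ‖y‖) := by
      gcongr; linarith
    have h3 : 9 * |C| * ‖y‖ ^ 2 ≤ 9 * |C| * ‖y‖ := by gcongr
    have := mul_nonneg (abs_nonneg C) hy0
    have := mul_nonneg (abs_nonneg σ) hy0
    linarith
  refine ⟨h₁ ▸ hlin _ _ hi₁ hr₁, h₂ ▸ hlin _ _ hi₂ hr₂, ?_⟩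
  have e1 : ‖e + y‖ ^ σ + ‖e - y‖ ^ σ - 2 = σ * ‖y‖ ^ 2 + (r₁ + r₂) := by
    rw [h₁, h₂]; ring
  rw [e1]
  refine (abs_add_le _ _).trans ?_
  rw [abs_mul, abs_of_nonneg (sq_nonneg ‖y‖)]
  have := abs_add_le r₁ r₂
  have := mul_nonneg (abs_nonneg σ) (sq_nonneg ‖y‖)
  nlinarith [sq_nonneg ‖y‖]

end Taylor

section Domination

lemma indicator_ball_norm_rpow_nonneg {E : Type*} [NormedAddCommGroup E] (τ : ℝ) (z : E) :
    0 ≤ (ball (0 : E) 1).indicator (fun z => ‖z‖ ^ τ) z :=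
  Set.indicator_nonneg (fun _ _ => by positivity) z

lemma norm_rpow_le_one_add_indicator {E : Type*} [NormedAddCommGroup E] {σ : ℝ} (hσ : σ < 0)
    (z : E) :
    ‖z‖ ^ σ ≤ 1 + (ball (0 : E) 1).indicator (fun z => ‖z‖ ^ σ) z := by
  by_cases hz : z ∈ ball (0 : E) 1
  · rw [Set.indicator_of_mem hz]; linarith
  · rw [Set.indicator_of_notMem hz, add_zero]
    exact Real.rpow_le_one_of_one_le_of_nonpos (by simpa using hz) hσ.le

variable {E : Type*} [NormedAddCommGroup E] [InnerProductSpace ℝ E] [FiniteDimensional ℝ E]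
  [MeasurableSpace E] [BorelSpace E] [Nontrivial E]

lemma integrable_indicator_ball_norm_rpow {τ : ℝ} (hτ : -(finrank ℝ E : ℝ) < τ) :
    Integrable ((ball (0 : E) 1).indicator fun z => ‖z‖ ^ τ) := by
  rw [integrable_indicator_iff measurableSet_ball]
  refine integrableOn_ball_of_norm_le_rpow (C := 1) (α := -τ) finrank_pos (by linarith)
    (Eventually.of_forall fun z => ?_) (measurable_norm.pow_const τ).aestronglyMeasurable
  rw [neg_neg, one_mul, Real.norm_of_nonneg (by positivity)]

/-- An integrable majorant for quotients `a y / ‖y‖ ^ p` whose numerator vanishes to second order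
at the origin and is elsewhere controlled by `‖·‖ ^ σ` centred at `±e`. -/
lemma exists_integrable_majorant {σ p C δ : ℝ} (hσ : -(finrank ℝ E : ℝ) < σ) (hσ0 : σ < 0)
    (hp : (finrank ℝ E : ℝ) < p) (hp2 : p < finrank ℝ E + 2) (hC : 0 ≤ C) (hδ : 0 < δ)
    (hδ1 : δ ≤ 1 / 2) (e : E) :
    ∃ H : E → ℝ, Integrable H ∧ ∀ (y : E) (a : ℝ), (‖y‖ < δ → |a| ≤ C * ‖y‖ ^ 2) →
      (δ ≤ ‖y‖ → |a| ≤ C * (1 + ‖e + y‖ ^ σ + ‖e - y‖ ^ σ)) → |a / ‖y‖ ^ p| ≤ H y := by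
  set φ : ℝ → E → ℝ := fun τ => (ball (0 : E) 1).indicator fun z => ‖z‖ ^ τ
  have hφ0 : ∀ τ z, 0 ≤ φ τ z := indicator_ball_norm_rpow_nonneg
  set M := (1 + 1 / δ) ^ p
  have hM : 0 < M := by positivity
  refine ⟨fun y => C * φ (2 - p) y +
    C * M * (3 * (1 + ‖y‖) ^ (-p) + φ σ (e + y) + φ σ (e - y)), ?_, fun y a hnear hfar => ?_⟩
  · have h1 := integrable_indicator_ball_norm_rpow (E := E) (τ := 2 - p) (by linarith)
    have h2 := integrable_indicator_ball_norm_rpow (E := E) hσ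
    exact (h1.const_mul C).add (((((integrable_one_add_norm hp).const_mul 3).add
      (h2.comp_add_left e)).add (h2.comp_sub_left e)).const_mul (C * M))
  have hfirst : 0 ≤ C * φ (2 - p) y := mul_nonneg hC (hφ0 _ _)
  have hsecond : 0 ≤ C * M * (3 * (1 + ‖y‖) ^ (-p) + φ σ (e + y) + φ σ (e - y)) := by
    have := hφ0 σ (e + y)
    have := hφ0 σ (e - y)
    positivity
  have hpp : 0 < p := lt_of_le_of_lt (Nat.cast_nonneg _) hp
  rcases eq_or_ne y 0 with rfl | hy
  · rw [norm_zero, Real.zero_rpow hpp.ne', div_zero, abs_zero]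
    linarith
  have hy0 : 0 < ‖y‖ := norm_pos_iff.2 hy
  rw [abs_div, abs_of_nonneg (Real.rpow_nonneg hy0.le p)]
  rcases lt_or_ge ‖y‖ δ with h | h
  · have h1 : φ (2 - p) y = ‖y‖ ^ (2 - p) :=
      Set.indicator_of_mem (by rw [mem_ball_zero_iff]; linarith) _
    have h2 : |a| / ‖y‖ ^ p ≤ C * φ (2 - p) y := by
      rw [h1, Real.rpow_sub hy0, Real.rpow_two, ← mul_div_assoc]
      gcongr
      exact hnear h
    linarith
  · have h1 : (‖y‖ ^ p)⁻¹ ≤ M * (1 + ‖y‖) ^ (-p) := by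
      rw [Real.rpow_neg (by positivity), ← div_eq_mul_inv, ← Real.div_rpow (by positivity)
        (by positivity), ← Real.inv_rpow hy0.le]
      refine Real.rpow_le_rpow (by positivity) ?_ hpp.le
      rw [le_div_iff₀ (by positivity), mul_add, inv_mul_cancel₀ hy0.ne', mul_one, ← one_div]
      linarith [one_div_le_one_div_of_le hδ h]
    have h2 : (1 + ‖y‖) ^ (-p) ≤ 1 :=
      Real.rpow_le_one_of_one_le_of_nonpos (by linarith) (by linarith)
    have h3 := norm_rpow_le_one_add_indicator hσ0 (e + y)
    have h4 := norm_rpow_le_one_add_indicator hσ0 (e - y)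
    have h5 : 0 < (1 + ‖y‖) ^ (-p) := by positivity
    calc |a| / ‖y‖ ^ p ≤ (C * (3 + φ σ (e + y) + φ σ (e - y))) * (M * (1 + ‖y‖) ^ (-p)) := by
          rw [div_eq_mul_inv]
          have := hφ0 σ (e + y)
          have := hφ0 σ (e - y)
          refine mul_le_mul ((hfar h).trans ?_) h1 (by positivity) (by positivity)
          refine mul_le_mul_of_nonneg_left ?_ hC
          linarith
      _ = C * M * (3 * (1 + ‖y‖) ^ (-p) + φ σ (e + y) * (1 + ‖y‖) ^ (-p) +
            φ σ (e - y) * (1 + ‖y‖) ^ (-p)) := by ring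
      _ ≤ C * M * (3 * (1 + ‖y‖) ^ (-p) + φ σ (e + y) + φ σ (e - y)) := by
          have := mul_le_of_le_one_right (hφ0 σ (e + y)) h2
          have := mul_le_of_le_one_right (hφ0 σ (e - y)) h2
          gcongr
      _ ≤ _ := by linarith

end Domination

section Cutoff

variable {E : Type*} [NormedAddCommGroup E]

/-- A cutoff around `e`, increasing to `1` as `ε` decreases to `0`. For a unit vector `e` it is
invariant under inversion in the unit sphere. -/
noncomputable def inversionCutoff (e : E) (ε : ℝ) (z : E) : ℝ :=
  ‖z - e‖ ^ 2 / (‖z - e‖ ^ 2 + ε * ‖z‖)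

lemma inversionCutoff_nonneg (e : E) {ε : ℝ} (hε : 0 ≤ ε) (z : E) :
    0 ≤ inversionCutoff e ε z := by
  unfold inversionCutoff; positivity

lemma inversionCutoff_le_one (e : E) {ε : ℝ} (hε : 0 ≤ ε) (z : E) :
    inversionCutoff e ε z ≤ 1 :=
  div_le_one_of_le₀ (le_add_of_nonneg_right (by positivity)) (by positivity)

lemma inversionCutoff_pos {e : E} {ε : ℝ} (hε : 0 ≤ ε) {z : E} (hz : z ≠ e) :
    0 < inversionCutoff e ε z := by
  have : 0 < ‖z - e‖ := norm_pos_iff.2 (sub_ne_zero.2 hz)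
  unfold inversionCutoff; positivity

lemma inversionCutoff_anti (e : E) {ε η : ℝ} (hε : 0 ≤ ε) (h : ε ≤ η) (z : E) :
    inversionCutoff e η z ≤ inversionCutoff e ε z := by
  rcases eq_or_ne z e with rfl | hz
  · simp [inversionCutoff]
  have : 0 < ‖z - e‖ := norm_pos_iff.2 (sub_ne_zero.2 hz)
  unfold inversionCutoff
  gcongr

lemma tendsto_inversionCutoff {e z : E} (hz : z ≠ e) {ι : Type*} {l : Filter ι} {ε : ι → ℝ}
    (hε : Tendsto ε l (𝓝 0)) : Tendsto (fun k => inversionCutoff e (ε k) z) l (𝓝 1) := by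
  have h : ‖z - e‖ ^ 2 ≠ 0 := pow_ne_zero _ (norm_ne_zero_iff.2 (sub_ne_zero.2 hz))
  have := (tendsto_const_nhds (x := ‖z - e‖ ^ 2)).div
    ((tendsto_const_nhds (x := ‖z - e‖ ^ 2)).add (hε.mul_const ‖z‖)) (by simpa using h)
  rw [zero_mul, add_zero, div_self h] at this
  exact this

lemma inversionCutoff_le_sq (e : E) {ε : ℝ} (hε : 0 < ε) {z : E} (hz : 1 / 2 ≤ ‖z‖) :
    inversionCutoff e ε z ≤ 2 / ε * ‖z - e‖ ^ 2 := by
  unfold inversionCutoff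
  rw [div_le_iff₀ (by positivity)]
  have h1 : 1 ≤ 2 / ε * (‖z - e‖ ^ 2 + ε * ‖z‖) := by
    have : 2 / ε * (‖z - e‖ ^ 2 + ε * ‖z‖) = 2 / ε * ‖z - e‖ ^ 2 + 2 * ‖z‖ := by field_simp
    rw [this]
    have : 0 ≤ 2 / ε * ‖z - e‖ ^ 2 := by positivity
    linarith
  nlinarith [sq_nonneg ‖z - e‖]

lemma abs_inversionCutoff_sub_le (e : E) {ε : ℝ} (hε : 0 < ε) {y : E}
    (h₁ : 1 / 2 ≤ ‖e + y‖) (h₂ : 1 / 2 ≤ ‖e - y‖) :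
    |inversionCutoff e ε (e + y) - inversionCutoff e ε (e - y)| ≤ 4 * ‖y‖ := by
  have h3 : |‖e - y‖ - ‖e + y‖| ≤ 2 * ‖y‖ := by
    refine (abs_norm_sub_norm_le _ _).trans ?_
    have : e - y - (e + y) = -(y + y) := by abel
    rw [this, norm_neg]
    linarith [norm_add_le y y]
  have hA : 0 < ‖y‖ ^ 2 + ε * ‖e + y‖ := by positivity
  have hB : 0 < ‖y‖ ^ 2 + ε * ‖e - y‖ := by positivity
  have h4 : inversionCutoff e ε (e + y) - inversionCutoff e ε (e - y) =
      ‖y‖ ^ 2 / (‖y‖ ^ 2 + ε * ‖e + y‖) * (ε / (‖y‖ ^ 2 + ε * ‖e - y‖)) *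
        (‖e - y‖ - ‖e + y‖) := by
    have e1 : e + y - e = y := by abel
    have e2 : e - y - e = -y := by abel
    rw [inversionCutoff, inversionCutoff, e1, e2, norm_neg]
    field_simp
    ring
  have h5 : ‖y‖ ^ 2 / (‖y‖ ^ 2 + ε * ‖e + y‖) ≤ 1 :=
    div_le_one_of_le₀ (le_add_of_nonneg_right (by positivity)) hA.le
  have h6 : ε / (‖y‖ ^ 2 + ε * ‖e - y‖) ≤ 2 := by
    rw [div_le_iff₀ hB]
    nlinarith [sq_nonneg ‖y‖]
  rw [h4, abs_mul, abs_of_nonneg (by positivity)]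
  calc _ ≤ 1 * 2 * (2 * ‖y‖) := by gcongr
    _ = 4 * ‖y‖ := by ring

lemma measurable_inversionCutoff [MeasurableSpace E] [BorelSpace E] [SecondCountableTopology E]
    (e : E) (ε : ℝ) : Measurable (inversionCutoff e ε) := by
  unfold inversionCutoff; fun_prop

variable [InnerProductSpace ℝ E]

lemma norm_inversion (z : E) : ‖EuclideanGeometry.inversion 0 1 z‖ = ‖z‖⁻¹ := by
  simpa using EuclideanGeometry.dist_inversion_center (0 : E) z 1

lemma norm_inversion_sub {e z : E} (he : ‖e‖ = 1) (hz : z ≠ 0) :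
    ‖EuclideanGeometry.inversion 0 1 z - e‖ = ‖z - e‖ / ‖z‖ := by
  have he0 : e ≠ 0 := norm_ne_zero_iff.1 (by rw [he]; exact one_ne_zero)
  have h := EuclideanGeometry.dist_inversion_inversion hz he0 1
  rw [EuclideanGeometry.inversion_of_mem_sphere (x := e) (by simpa using he)] at h
  simp only [dist_eq_norm, sub_zero, he] at h
  rw [h]
  ring

lemma inversionCutoff_inversion {e z : E} (he : ‖e‖ = 1) (hz : z ≠ 0) (ε : ℝ) :
    inversionCutoff e ε (EuclideanGeometry.inversion 0 1 z) = inversionCutoff e ε z := by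
  have : ‖z‖ ≠ 0 := norm_ne_zero_iff.2 hz
  rw [inversionCutoff, inversionCutoff, norm_inversion, norm_inversion_sub he hz]
  have h : (‖z - e‖ / ‖z‖) ^ 2 + ε * ‖z‖⁻¹ = (‖z - e‖ ^ 2 + ε * ‖z‖) / ‖z‖ ^ 2 := by
    field_simp
  rw [h, div_pow, div_div_div_cancel_right₀ (pow_ne_zero 2 this)]

end Cutoff

section Positivity

variable {E : Type*} [NormedAddCommGroup E]

/-- The difference quotient `(‖z‖ ^ σ - 1) / ‖z - e‖ ^ p` with its singularity at `e` cut off. -/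
noncomputable def truncatedDiff (σ p : ℝ) (e : E) (ε : ℝ) (z : E) : ℝ :=
  (‖z‖ ^ σ - 1) * inversionCutoff e ε z / ‖z - e‖ ^ p

lemma truncatedDiff_add (σ p : ℝ) (e : E) (ε : ℝ) (y : E) :
    truncatedDiff σ p e ε (e + y) =
      (‖e + y‖ ^ σ - 1) * inversionCutoff e ε (e + y) / ‖y‖ ^ p := by
  rw [truncatedDiff, add_sub_cancel_left]

lemma truncatedDiff_sub (σ p : ℝ) (e : E) (ε : ℝ) (y : E) :
    truncatedDiff σ p e ε (e - y) =
      (‖e - y‖ ^ σ - 1) * inversionCutoff e ε (e - y) / ‖y‖ ^ p := by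
  rw [truncatedDiff, sub_sub_cancel_left, norm_neg]

lemma half_le_norm_add {e y : E} (he : ‖e‖ = 1) (hy : ‖y‖ ≤ 1 / 2) : 1 / 2 ≤ ‖e + y‖ := by
  have := norm_sub_norm_le e (-y)
  rw [sub_neg_eq_add, norm_neg] at this
  linarith

lemma half_le_norm_sub {e y : E} (he : ‖e‖ = 1) (hy : ‖y‖ ≤ 1 / 2) : 1 / 2 ≤ ‖e - y‖ := by
  linarith [norm_sub_norm_le e y]

variable [InnerProductSpace ℝ E]

/-- Adding to the truncated difference quotient its image under inversion gives a product of
two factors of the same sign. -/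
lemma truncatedDiff_add_inversion (σ p : ℝ) {e z : E} (he : ‖e‖ = 1) (hz : z ≠ 0) (ε : ℝ) :
    truncatedDiff σ p e ε z + (‖z‖ ^ (2 * finrank ℝ E))⁻¹ *
        truncatedDiff σ p e ε (EuclideanGeometry.inversion 0 1 z) =
      (‖z‖ ^ σ - 1) * (1 - ‖z‖ ^ (p - 2 * finrank ℝ E - σ)) *
        inversionCutoff e ε z / ‖z - e‖ ^ p := by
  have ht : 0 < ‖z‖ := norm_pos_iff.2 hz
  rw [truncatedDiff, truncatedDiff, inversionCutoff_inversion he hz, norm_inversion,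
    norm_inversion_sub he hz, Real.div_rpow (norm_nonneg _) ht.le, Real.inv_rpow ht.le,
    Real.rpow_sub ht, Real.rpow_sub ht]
  have h : ‖z‖ ^ (2 * (finrank ℝ E : ℝ)) = ‖z‖ ^ (2 * finrank ℝ E) := by
    rw [← Real.rpow_natCast]; push_cast; rfl
  rw [h]
  have h1 : ‖z‖ ^ σ ≠ 0 := (Real.rpow_pos_of_pos ht σ).ne'
  have h2 : ‖z‖ ^ (2 * finrank ℝ E) ≠ 0 := by positivity
  rw [div_div_eq_mul_div, mul_div_assoc', ← add_div]
  congr 1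
  field_simp
  ring

lemma rpow_sub_one_mul_one_sub_rpow_nonneg {σ β t : ℝ} (ht : 0 < t) (hσ : σ ≤ 0) (hβ : 0 ≤ β) :
    0 ≤ (t ^ σ - 1) * (1 - t ^ β) := by
  rcases le_total t 1 with h | h
  · exact mul_nonneg (sub_nonneg.2 (Real.one_le_rpow_of_pos_of_le_one_of_nonpos ht h hσ))
      (sub_nonneg.2 (Real.rpow_le_one ht.le h hβ))
  · exact mul_nonneg_of_nonpos_of_nonpos
      (sub_nonpos.2 (Real.rpow_le_one_of_one_le_of_nonpos h hσ))
      (sub_nonpos.2 (Real.one_le_rpow h hβ))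

variable [FiniteDimensional ℝ E] [MeasurableSpace E] [BorelSpace E]

lemma measurable_truncatedDiff (σ p : ℝ) (e : E) (ε : ℝ) :
    Measurable (truncatedDiff σ p e ε) :=
  (((measurable_norm.pow_const σ).sub_const 1).mul (measurable_inversionCutoff e ε)).div
    ((measurable_id.sub_const e).norm.pow_const p)

variable [Nontrivial E] {σ p : ℝ} {e : E}

lemma integrable_truncatedDiff (hσ : -(finrank ℝ E : ℝ) < σ) (hσ0 : σ < 0)
    (hp : (finrank ℝ E : ℝ) < p) (hp2 : p < finrank ℝ E + 2) (he : ‖e‖ = 1) {ε : ℝ} (hε : 0 < ε) :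
    Integrable (truncatedDiff σ p e ε) := by
  obtain ⟨C, hC, δ, hδ, hδ1, hCδ⟩ := norm_rpow_differences σ he
  obtain ⟨H, hH, hbound⟩ := exists_integrable_majorant (C := C * (2 / ε) + 1) hσ hσ0 hp hp2
    (by positivity) hδ hδ1 e
  have hint : Integrable fun y => truncatedDiff σ p e ε (e + y) := by
    refine hH.mono' ((measurable_truncatedDiff σ p e ε).comp
      (measurable_const_add e)).aestronglyMeasurable (Eventually.of_forall fun y => ?_)
    rw [truncatedDiff_add, Real.norm_eq_abs]
    have hw0 := inversionCutoff_nonneg e hε.le (e + y)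
    refine hbound y _ (fun hy => ?_) fun _ => ?_
    · have h1 := inversionCutoff_le_sq e hε (half_le_norm_add he (hy.le.trans hδ1))
      rw [add_sub_cancel_left] at h1
      have h2 : |‖e + y‖ ^ σ - 1| ≤ C :=
        (hCδ y hy).1.trans (mul_le_of_le_one_right hC.le (by linarith))
      rw [abs_mul, abs_of_nonneg hw0]
      calc _ ≤ C * (2 / ε * ‖y‖ ^ 2) := by gcongr
        _ ≤ (C * (2 / ε) + 1) * ‖y‖ ^ 2 := by nlinarith [sq_nonneg ‖y‖]
    · have h1 := inversionCutoff_le_one e hε.le (e + y)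
      have h2 : |‖e + y‖ ^ σ - 1| ≤ 1 + ‖e + y‖ ^ σ + ‖e - y‖ ^ σ := by
        have h3 : 0 ≤ ‖e + y‖ ^ σ := by positivity
        have h4 : 0 ≤ ‖e - y‖ ^ σ := by positivity
        rw [abs_le]
        constructor <;> linarith
      rw [abs_mul, abs_of_nonneg hw0]
      refine (mul_le_of_le_one_right (abs_nonneg _) h1).trans (h2.trans ?_)
      exact le_mul_of_one_le_left (by positivity) (le_add_of_nonneg_left (by positivity))
  simpa [sub_eq_add_neg] using hint.comp_add_left (-e)

/-- The integral of the truncated difference quotient has a positive lower bound which is uniform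
in the truncation parameter. -/
lemma exists_pos_le_integral_truncatedDiff (hσ : -(finrank ℝ E : ℝ) < σ) (hσ0 : σ < 0)
    (hp : (finrank ℝ E : ℝ) < p) (hp2 : p < finrank ℝ E + 2)
    (hσp : σ < p - 2 * finrank ℝ E) (he : ‖e‖ = 1) :
    ∃ c > 0, ∀ ε, 0 < ε → ε ≤ 1 → c ≤ 2 * ∫ z, truncatedDiff σ p e ε z := by
  set F : ℝ → E → ℝ := fun ε z => (‖z‖ ^ σ - 1) * (1 - ‖z‖ ^ (p - 2 * finrank ℝ E - σ)) *
    inversionCutoff e ε z / ‖z - e‖ ^ p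
  have hne : ∀ᵐ z : E, z ≠ 0 := by simp [ae_iff]
  have hae : ∀ ε, (fun z => truncatedDiff σ p e ε z + (‖z‖ ^ (2 * finrank ℝ E))⁻¹ *
      truncatedDiff σ p e ε (EuclideanGeometry.inversion 0 1 z)) =ᵐ[volume] F ε := fun ε => by
    filter_upwards [hne] with z hz using truncatedDiff_add_inversion σ p he hz ε
  have hFint : ∀ ε, 0 < ε → Integrable (F ε) := fun ε hε => by
    have h := integrable_truncatedDiff hσ hσ0 hp hp2 he hε
    exact (h.add (integrable_comp_inversion h)).congr (hae ε)
  have hFeq : ∀ ε, 0 < ε → ∫ z, F ε z = 2 * ∫ z, truncatedDiff σ p e ε z := fun ε hε => by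
    have h := integrable_truncatedDiff hσ hσ0 hp hp2 he hε
    rw [← integral_congr_ae (hae ε), integral_add h (integrable_comp_inversion h),
      integral_comp_inversion, two_mul]
  have hsign : ∀ z : E, z ≠ 0 →
      0 ≤ (‖z‖ ^ σ - 1) * (1 - ‖z‖ ^ (p - 2 * finrank ℝ E - σ)) := fun z hz =>
    rpow_sub_one_mul_one_sub_rpow_nonneg (norm_pos_iff.2 hz) hσ0.le (by linarith)
  refine ⟨∫ z, F 1 z, ?_, fun ε hε hε1 => ?_⟩
  · have hnn : 0 ≤ᵐ[volume] F 1 := by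
      filter_upwards [hne] with z hz
      exact div_nonneg (mul_nonneg (hsign z hz) (inversionCutoff_nonneg e zero_le_one z))
        (by positivity)
    rw [gt_iff_lt, integral_pos_iff_support_of_nonneg_ae hnn (hFint 1 one_pos)]
    have hopen : IsOpen (ball (0 : E) 1 ∩ {0}ᶜ) := isOpen_ball.inter isOpen_compl_singleton
    refine (hopen.measure_pos volume ⟨(1 / 2 : ℝ) • e, ?_, ?_⟩).trans_le (measure_mono ?_)
    · rw [mem_ball_zero_iff, norm_smul, he]; norm_num
    · have : e ≠ 0 := norm_ne_zero_iff.1 (by rw [he]; exact one_ne_zero)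
      simpa using this
    · rintro z ⟨hz1, hz0⟩
      rw [mem_ball_zero_iff] at hz1
      have ht : 0 < ‖z‖ := norm_pos_iff.2 hz0
      have hze : z ≠ e := by rintro rfl; exact hz1.ne he
      have hq : 0 < ‖z - e‖ := norm_pos_iff.2 (sub_ne_zero.2 hze)
      have h1 := Real.one_lt_rpow_of_pos_of_lt_one_of_neg ht hz1 hσ0
      have h2 := Real.rpow_lt_one ht.le hz1 (z := p - 2 * finrank ℝ E - σ) (by linarith)
      exact (div_pos (mul_pos (mul_pos (sub_pos.2 h1) (sub_pos.2 h2))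
        (inversionCutoff_pos zero_le_one hze)) (Real.rpow_pos_of_pos hq p)).ne'
  · rw [← hFeq ε hε]
    refine integral_mono_ae (hFint 1 one_pos) (hFint ε hε) ?_
    filter_upwards [hne] with z hz
    exact div_le_div_of_nonneg_right (mul_le_mul_of_nonneg_left
      (inversionCutoff_anti e hε.le hε1 z) (hsign z hz)) (by positivity)

lemma tendsto_integral_truncatedDiff (hσ : -(finrank ℝ E : ℝ) < σ) (hσ0 : σ < 0)
    (hp : (finrank ℝ E : ℝ) < p) (hp2 : p < finrank ℝ E + 2) (he : ‖e‖ = 1)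
    {ε : ℕ → ℝ} (hε : ∀ k, 0 < ε k) (hlim : Tendsto ε atTop (𝓝 0)) :
    Tendsto (fun k => 2 * ∫ z, truncatedDiff σ p e (ε k) z) atTop
      (𝓝 (∫ y, (‖e + y‖ ^ σ + ‖e - y‖ ^ σ - 2) / ‖y‖ ^ p)) := by
  obtain ⟨C, hC, δ, hδ, hδ1, hCδ⟩ := norm_rpow_differences σ he
  obtain ⟨H, hH, hbound⟩ := exists_integrable_majorant (C := C + C * 4 + 2) hσ hσ0 hp hp2
    (by positivity) hδ hδ1 e
  have hsum : ∀ k, 2 * ∫ z, truncatedDiff σ p e (ε k) z =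
      ∫ y, (truncatedDiff σ p e (ε k) (e + y) + truncatedDiff σ p e (ε k) (e - y)) := fun k => by
    have h := integrable_truncatedDiff hσ hσ0 hp hp2 he (hε k)
    rw [integral_add (h.comp_add_left e) (h.comp_sub_left e),
      integral_add_left_eq_self (fun z => truncatedDiff σ p e (ε k) z),
      integral_sub_left_eq_self (fun z => truncatedDiff σ p e (ε k) z), two_mul]
  simp_rw [hsum]
  refine tendsto_integral_of_dominated_convergence H (fun k => ?_) hH
    (fun k => Eventually.of_forall fun y => ?_) ?_
  · have h := measurable_truncatedDiff σ p e (ε k)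
    exact ((h.comp (measurable_const_add e)).add
      (h.comp (measurable_const_sub e))).aestronglyMeasurable
  · rw [truncatedDiff_add, truncatedDiff_sub, ← add_div, Real.norm_eq_abs]
    have hw0 := inversionCutoff_nonneg e (hε k).le (e + y)
    have hw1 := inversionCutoff_le_one e (hε k).le (e + y)
    have hv0 := inversionCutoff_nonneg e (hε k).le (e - y)
    have hv1 := inversionCutoff_le_one e (hε k).le (e - y)
    refine hbound y _ (fun hy => ?_) fun _ => ?_
    · obtain ⟨-, h1, h2⟩ := hCδ y hy
      have h3 := abs_inversionCutoff_sub_le e (hε k) (half_le_norm_add he (hy.le.trans hδ1))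
        (half_le_norm_sub he (hy.le.trans hδ1))
      rw [abs_sub_comm] at h3
      have h4 : (‖e + y‖ ^ σ - 1) * inversionCutoff e (ε k) (e + y) +
          (‖e - y‖ ^ σ - 1) * inversionCutoff e (ε k) (e - y) =
          (‖e + y‖ ^ σ + ‖e - y‖ ^ σ - 2) * inversionCutoff e (ε k) (e + y) +
          (‖e - y‖ ^ σ - 1) *
            (inversionCutoff e (ε k) (e - y) - inversionCutoff e (ε k) (e + y)) := by ring
      rw [h4]
      refine (abs_add_le _ _).trans ?_
      rw [abs_mul, abs_mul, abs_of_nonneg hw0]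
      calc _ ≤ C * ‖y‖ ^ 2 * 1 + C * ‖y‖ * (4 * ‖y‖) := by gcongr
        _ ≤ (C + C * 4 + 2) * ‖y‖ ^ 2 := by nlinarith [sq_nonneg ‖y‖]
    · have ha : 0 ≤ ‖e + y‖ ^ σ := by positivity
      have hb : 0 ≤ ‖e - y‖ ^ σ := by positivity
      have h1 : ∀ a w : ℝ, 0 ≤ a → 0 ≤ w → w ≤ 1 → |(a - 1) * w| ≤ 1 + a := by
        intro a w ha hw hw'
        rw [abs_mul, abs_of_nonneg hw]
        refine (mul_le_of_le_one_right (abs_nonneg _) hw').trans ?_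
        rw [abs_le]
        constructor <;> linarith
      refine (abs_add_le _ _).trans ?_
      have h2 := h1 _ _ ha hw0 hw1
      have h3 := h1 _ _ hb hv0 hv1
      have h4 : 2 * (1 + ‖e + y‖ ^ σ + ‖e - y‖ ^ σ) ≤
          (C + C * 4 + 2) * (1 + ‖e + y‖ ^ σ + ‖e - y‖ ^ σ) := by
        gcongr
        exact le_add_of_nonneg_left (by positivity)
      linarith
  · have hne : ∀ᵐ y : E, y ≠ 0 := by simp [ae_iff]
    filter_upwards [hne] with y hy
    simp_rw [truncatedDiff_add, truncatedDiff_sub, ← add_div]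
    have h1 := tendsto_inversionCutoff (e := e) (z := e + y) (by simpa using hy) hlim
    have h2 := tendsto_inversionCutoff (e := e) (z := e - y) (by simpa using hy) hlim
    have h3 := ((h1.const_mul (‖e + y‖ ^ σ - 1)).add
      (h2.const_mul (‖e - y‖ ^ σ - 1))).div_const (‖y‖ ^ p)
    convert h3 using 2
    ring

lemma integral_second_difference_pos (hσ : -(finrank ℝ E : ℝ) < σ) (hσ0 : σ < 0)
    (hp : (finrank ℝ E : ℝ) < p) (hp2 : p < finrank ℝ E + 2)
    (hσp : σ < p - 2 * finrank ℝ E) (he : ‖e‖ = 1) :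
    0 < ∫ y, (‖e + y‖ ^ σ + ‖e - y‖ ^ σ - 2) / ‖y‖ ^ p := by
  obtain ⟨c, hc, hle⟩ := exists_pos_le_integral_truncatedDiff hσ hσ0 hp hp2 hσp he
  have hlim := tendsto_integral_truncatedDiff hσ hσ0 hp hp2 he
    (fun k : ℕ => Nat.one_div_pos_of_nat) tendsto_one_div_add_atTop_nhds_zero_nat
  refine hc.trans_le (ge_of_tendsto' hlim fun k => hle _ Nat.one_div_pos_of_nat ?_)
  rw [div_le_one (by positivity)]
  linarith [(Nat.cast_nonneg k : (0 : ℝ) ≤ k)]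

/-- Scaling reduces the second difference at `x ≠ 0` to the one at a unit vector. -/
lemma integral_second_difference_pos_of_ne_zero (hσ : -(finrank ℝ E : ℝ) < σ) (hσ0 : σ < 0)
    (hp : (finrank ℝ E : ℝ) < p) (hp2 : p < finrank ℝ E + 2)
    (hσp : σ < p - 2 * finrank ℝ E) {x : E} (hx : x ≠ 0) :
    0 < ∫ y, (‖x + y‖ ^ σ + ‖x - y‖ ^ σ - 2 * ‖x‖ ^ σ) / ‖y‖ ^ p := by
  have hR : 0 < ‖x‖ := norm_pos_iff.2 hx
  set e : E := ‖x‖⁻¹ • x with he_def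
  have he : ‖e‖ = 1 := norm_smul_inv_norm (𝕜 := ℝ) hx
  have hxe : x = ‖x‖ • e := by rw [he_def, smul_inv_smul₀ hR.ne']
  have hscale := Measure.integral_comp_smul (volume : Measure E)
    (fun y => (‖x + y‖ ^ σ + ‖x - y‖ ^ σ - 2 * ‖x‖ ^ σ) / ‖y‖ ^ p) ‖x‖
  have hpt : ∀ y : E, (‖x + ‖x‖ • y‖ ^ σ + ‖x - ‖x‖ • y‖ ^ σ - 2 * ‖x‖ ^ σ) / ‖‖x‖ • y‖ ^ p =
      ‖x‖ ^ σ / ‖x‖ ^ p * ((‖e + y‖ ^ σ + ‖e - y‖ ^ σ - 2) / ‖y‖ ^ p) := fun y => by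
    have h1 : ‖x + ‖x‖ • y‖ = ‖x‖ * ‖e + y‖ := by
      rw [← norm_smul_of_nonneg hR.le, smul_add, ← hxe]
    have h2 : ‖x - ‖x‖ • y‖ = ‖x‖ * ‖e - y‖ := by
      rw [← norm_smul_of_nonneg hR.le, smul_sub, ← hxe]
    rw [h1, h2, norm_smul_of_nonneg hR.le, Real.mul_rpow hR.le (norm_nonneg _),
      Real.mul_rpow hR.le (norm_nonneg _), Real.mul_rpow hR.le (norm_nonneg _),
      div_mul_div_comm]
    ring
  simp_rw [hpt, integral_const_mul, smul_eq_mul] at hscale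
  have hpos : 0 < ‖x‖ ^ σ / ‖x‖ ^ p * ∫ y, (‖e + y‖ ^ σ + ‖e - y‖ ^ σ - 2) / ‖y‖ ^ p :=
    mul_pos (by positivity) (integral_second_difference_pos hσ hσ0 hp hp2 hσp he)
  rw [hscale] at hpos
  exact pos_of_mul_pos_right hpos (abs_nonneg _)

end Positivity

end FractionalLaplacianOfPowers

/-- for σ ∈ (−n, −n+2s), (−Δ)^s |·|^σ (x) < 0 whenever |x| > 1. -/
theorem stmt_9 (n : ℕ) (s σ : ℝ) (hn : 2 ≤ n) (hs : 0 < s) (hs1 : s < 1)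
    (hns : 2 * s < (n : ℝ)) (hσ : σ ∈ Set.Ioo (-(n : ℝ)) (-(n : ℝ) + 2 * s))
    (x : EuclideanSpace ℝ (Fin n)) (hx : 1 < ‖x‖) :
    fracLap n s (fun y => ‖y‖ ^ σ) x < 0 := by
  obtain ⟨hσ1, hσ2⟩ := hσ
  have hd : Module.finrank ℝ (EuclideanSpace ℝ (Fin n)) = n := finrank_euclideanSpace_fin
  have : Nontrivial (EuclideanSpace ℝ (Fin n)) :=
    Module.nontrivial_of_finrank_pos (R := ℝ) (by omega)
  have hx0 : x ≠ 0 := norm_pos_iff.1 (by linarith)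
  have h := integral_second_difference_pos_of_ne_zero (σ := σ) (p := (n : ℝ) + 2 * s)
    (by rw [hd]; exact hσ1) (by linarith) (by rw [hd]; linarith) (by rw [hd]; linarith)
    (by rw [hd]; linarith) hx0
  unfold fracLap
  linarith
end

section
/- Let n ≥ 2, 0 < s < 1 with n > 2s, and let u ≢ 0 be a nonnegative viscosity super-solution of (−Δ)^s u = 0 in ℝⁿ. Then for each R₀ > 1 and each σ ∈ (−n, −n+2s) there exists C > 0, independent of u, such that min_{|x|≤r} u(x) ≥ C · (min_{|x|≤R₀} u(x)) · r^σ for all r ≥ R₀. -/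
open MeasureTheory

/-- `u` is a viscosity super-solution of `(-Δ)^s u = f` in all of ℝⁿ: whenever a
C² function `φ` touches `u` from below at a point `x₀`, one has
`(-Δ)^s φ (x₀) ≥ f x₀`. -/
def ViscSupersol (n : ℕ) (s : ℝ) (f u : EuclideanSpace ℝ (Fin n) → ℝ) : Prop :=
  Continuous u ∧
  ∀ (x₀ : EuclideanSpace ℝ (Fin n)) (φ : EuclideanSpace ℝ (Fin n) → ℝ),
    ContDiff ℝ 2 φ → φ x₀ = u x₀ → (∀ x, φ x ≤ u x) → f x₀ ≤ fracLap n s φ x₀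

open Set Filter Topology

/-- Integrability of `w ^ (-s - 1) * h w` on `(0, ∞)` for `h` vanishing at the origin,
differentiable there, and growing at most like `w ^ κ` with `κ < s`. -/
lemma integrableOn_rpow_mul_of_growth {s κ C : ℝ} {h : ℝ → ℝ} (hs1 : s < 1) (hκ : 0 ≤ κ)
    (hκs : κ < s) (hc : ContinuousOn h (Ioi 0)) (h0 : h 0 = 0) (hd : DifferentiableAt ℝ h 0)
    (hC : ∀ w, 0 ≤ w → |h w| ≤ C * (1 + w) ^ κ) :
    IntegrableOn (fun w : ℝ => w ^ (-s - 1) * h w) (Ioi 0) := by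
  refine mellin_convergent_of_isBigO_scalar (a := -κ) (b := -1)
    (hc.locallyIntegrableOn measurableSet_Ioi) ?_ (by linarith) ?_ (by linarith)
  · refine Asymptotics.IsBigO.of_bound (|C| * 2 ^ κ) ?_
    filter_upwards [eventually_ge_atTop (1 : ℝ)] with w hw
    have hw0 : (0 : ℝ) ≤ w := by linarith
    rw [neg_neg, Real.norm_eq_abs, Real.norm_eq_abs, abs_of_nonneg (Real.rpow_nonneg hw0 κ),
      mul_assoc, ← Real.mul_rpow (by norm_num) hw0]
    calc |h w| ≤ C * (1 + w) ^ κ := hC w hw0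
      _ ≤ |C| * (1 + w) ^ κ := by gcongr; exact le_abs_self C
      _ ≤ |C| * (2 * w) ^ κ := by gcongr; linarith
  · have := hd.hasDerivAt.isBigO_sub
    simp only [h0, sub_zero] at this
    refine (this.mono nhdsWithin_le_nhds).congr_right ?_
    intro w
    simp

lemma rpow_neg_midpoint_le {γ a b : ℝ} (hγ : 0 ≤ γ) (ha : 0 < a) (hb : 0 < b) :
    2 * ((a + b) / 2) ^ (-γ) ≤ a ^ (-γ) + b ^ (-γ) := by
  have hsq : ∀ t : ℝ, 0 < t → t ^ (-γ) = (t ^ (-γ / 2)) ^ 2 := fun t ht => by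
    rw [← Real.rpow_natCast, ← Real.rpow_mul ht.le]
    congr 1
    push_cast
    ring
  have h1 : ((a + b) / 2) ^ (-γ) ≤ a ^ (-γ / 2) * b ^ (-γ / 2) := by
    rw [← Real.mul_rpow ha.le hb.le, hsq _ (by positivity), sq, ← Real.mul_rpow (by positivity)
      (by positivity)]
    refine Real.rpow_le_rpow_of_nonpos (by positivity) ?_ (by linarith)
    nlinarith [sq_nonneg (a - b)]
  rw [hsq a ha, hsq b hb]
  nlinarith [sq_nonneg (a ^ (-γ / 2) - b ^ (-γ / 2))]

lemma integrableOn_rpow_mul_one_add {p γ : ℝ} (hp : 0 < p) (hpγ : p < γ) :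
    IntegrableOn (fun w : ℝ => w ^ (p - 1) * (1 + w) ^ (-γ)) (Ioi 0) := by
  have hcont : ContinuousOn (fun w : ℝ => (1 + w) ^ (-γ)) (Ioi 0) := by
    refine ContinuousOn.rpow_const (by fun_prop) fun w hw => Or.inl ?_
    have : (0 : ℝ) < w := hw
    positivity
  refine mellin_convergent_of_isBigO_scalar (a := γ) (b := 0)
    (hcont.locallyIntegrableOn measurableSet_Ioi) ?_ hpγ ?_ hp
  · refine Asymptotics.IsBigO.of_bound 1 ?_
    filter_upwards [eventually_gt_atTop (0 : ℝ)] with w hw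
    rw [Real.norm_of_nonneg (by positivity), Real.norm_of_nonneg (by positivity), one_mul]
    exact Real.rpow_le_rpow_of_nonpos hw (by linarith) (by linarith)
  · refine Asymptotics.IsBigO.of_bound 1 ?_
    filter_upwards [self_mem_nhdsWithin] with w hw
    have hw' : (0 : ℝ) < w := hw
    rw [Real.norm_of_nonneg (by positivity), neg_zero, Real.rpow_zero, norm_one, one_mul]
    exact Real.rpow_le_one_of_one_le_of_nonpos (by linarith) (by linarith)

lemma setIntegral_Ioi_pos {f : ℝ → ℝ} {a : ℝ} (hpos : ∀ w ∈ Ioi a, 0 < f w)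
    (hf : IntegrableOn f (Ioi a)) : 0 < ∫ w in Ioi a, f w := by
  have hsub : Ioi a ⊆ Function.support f := fun w hw => (hpos w hw).ne'
  rw [setIntegral_pos_iff_support_of_nonneg_ae
    ((ae_restrict_iff' measurableSet_Ioi).2 (ae_of_all _ fun w hw => (hpos w hw).le)) hf,
    inter_eq_self_of_subset_right hsub]
  simp

/-- The beta-type integral `∫₀^∞ w^(p-1) (1+w)^(-γ) dw`. -/
noncomputable def betaConst (p γ : ℝ) : ℝ := ∫ w in Ioi (0 : ℝ), w ^ (p - 1) * (1 + w) ^ (-γ)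

lemma betaConst_pos {p γ : ℝ} (hp : 0 < p) (hpγ : p < γ) : 0 < betaConst p γ := by
  have hpos : ∀ w ∈ Ioi (0 : ℝ), 0 < w ^ (p - 1) * (1 + w) ^ (-γ) := fun w hw => by
    have : (0 : ℝ) < w := hw
    positivity
  exact setIntegral_Ioi_pos hpos (integrableOn_rpow_mul_one_add hp hpγ)

lemma integral_rpow_mul_rpow_affine {p γ a Y : ℝ} (hp : 0 < p) (hpγ : p < γ) (ha : 0 < a)
    (hY : 0 < Y) :
    IntegrableOn (fun w : ℝ => w ^ (p - 1) * (w * a + Y) ^ (-γ)) (Ioi 0) ∧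
    ∫ w in Ioi (0 : ℝ), w ^ (p - 1) * (w * a + Y) ^ (-γ)
      = betaConst p γ * a ^ (-p) * Y ^ (p - γ) := by
  have key : ∀ w ∈ Ioi (0 : ℝ), w ^ (p - 1) * (w * a + Y) ^ (-γ)
      = ((a / Y) ^ (1 - p) * Y ^ (-γ)) * ((a / Y * w) ^ (p - 1) * (1 + a / Y * w) ^ (-γ)) := by
    intro w hw
    have hw' : (0 : ℝ) < w := hw
    have e : w * a + Y = Y * (1 + a / Y * w) := by field_simp; ring
    rw [e, Real.mul_rpow hY.le (by positivity), Real.mul_rpow (x := a / Y) (by positivity) hw'.le]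
    have : (a / Y) ^ (1 - p) * (a / Y) ^ (p - 1) = 1 := by
      rw [← Real.rpow_add (by positivity)]
      simp
    linear_combination (-(w ^ (p - 1) * Y ^ (-γ) * (1 + a / Y * w) ^ (-γ))) * this
  have hdiv : 0 < a / Y := by positivity
  constructor
  · refine IntegrableOn.congr_fun ?_ (fun w hw => (key w hw).symm) measurableSet_Ioi
    refine Integrable.const_mul ?_ _
    have := (integrableOn_Ioi_comp_mul_left_iff
      (fun w : ℝ => w ^ (p - 1) * (1 + w) ^ (-γ)) 0 hdiv).2
    rw [mul_zero] at this
    exact this (integrableOn_rpow_mul_one_add hp hpγ)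
  · rw [setIntegral_congr_fun measurableSet_Ioi key, integral_const_mul,
      integral_comp_mul_left_Ioi (fun w : ℝ => w ^ (p - 1) * (1 + w) ^ (-γ)) 0 hdiv, mul_zero,
      smul_eq_mul, ← betaConst]
    have h1 : (a / Y) ^ (1 - p) * (a / Y)⁻¹ = a ^ (-p) * Y ^ p := by
      rw [← Real.rpow_neg_one (a / Y), ← Real.rpow_add hdiv, Real.div_rpow ha.le hY.le,
        div_eq_mul_inv, ← Real.rpow_neg hY.le]
      congr 2 <;> ring
    rw [sub_eq_add_neg p γ, Real.rpow_add hY]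
    linear_combination (Y ^ (-γ) * betaConst p γ) * h1

section Spatial

variable {n : ℕ}

/-- The integral of `(1 + ‖y‖²)^(-γ)` over `ℝⁿ`. -/
noncomputable def japaneseConst (n : ℕ) (γ : ℝ) : ℝ :=
  ∫ y : EuclideanSpace ℝ (Fin n), (1 + ‖y‖ ^ 2) ^ (-γ)

lemma integrable_one_add_norm_sq_rpow {γ : ℝ} (hγ : (n : ℝ) / 2 < γ) :
    Integrable fun y : EuclideanSpace ℝ (Fin n) => (1 + ‖y‖ ^ 2) ^ (-γ) := by
  have := integrable_rpow_neg_one_add_norm_sq (E := EuclideanSpace ℝ (Fin n)) (μ := volume)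
    (r := 2 * γ) (by rw [finrank_euclideanSpace_fin]; linarith)
  convert this using 3
  ring

lemma japaneseConst_pos {γ : ℝ} (hγ : (n : ℝ) / 2 < γ) : 0 < japaneseConst n γ := by
  have hpos : ∀ y : EuclideanSpace ℝ (Fin n), 0 < (1 + ‖y‖ ^ 2) ^ (-γ) := fun y => by positivity
  have hsupp : Function.support (fun y : EuclideanSpace ℝ (Fin n) => (1 + ‖y‖ ^ 2) ^ (-γ)) = univ :=
    eq_univ_of_forall fun y => (hpos y).ne'
  rw [japaneseConst, integral_pos_iff_support_of_nonneg (fun y => (hpos y).le)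
    (integrable_one_add_norm_sq_rpow hγ), hsupp]
  exact Measure.measure_univ_pos.2 (NeZero.ne _)

lemma integral_rpow_quadratic {γ M K : ℝ} (hγ : (n : ℝ) / 2 < γ) (hM : 0 < M) (hK : 0 < K)
    (v : EuclideanSpace ℝ (Fin n)) :
    Integrable (fun y : EuclideanSpace ℝ (Fin n) => (M + K * ‖y + v‖ ^ 2) ^ (-γ)) ∧
    ∫ y : EuclideanSpace ℝ (Fin n), (M + K * ‖y + v‖ ^ 2) ^ (-γ)
      = japaneseConst n γ * M ^ ((n : ℝ) / 2 - γ) * K ^ (-((n : ℝ) / 2)) := by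
  have hKM : 0 < K / M := by positivity
  have key : ∀ y : EuclideanSpace ℝ (Fin n), (M + K * ‖y‖ ^ 2) ^ (-γ)
      = M ^ (-γ) * (1 + ‖√(K / M) • y‖ ^ 2) ^ (-γ) := by
    intro y
    rw [← Real.mul_rpow hM.le (by positivity), norm_smul, mul_pow, Real.norm_eq_abs, sq_abs,
      Real.sq_sqrt hKM.le]
    congr 1
    field_simp
  have hMK : Integrable fun y : EuclideanSpace ℝ (Fin n) => (M + K * ‖y‖ ^ 2) ^ (-γ) := by
    simp_rw [key]
    exact ((integrable_one_add_norm_sq_rpow hγ).comp_smul (Real.sqrt_pos.2 hKM).ne').const_mul _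
  refine ⟨hMK.comp_add_right v, ?_⟩
  rw [integral_add_right_eq_self fun y : EuclideanSpace ℝ (Fin n) => (M + K * ‖y‖ ^ 2) ^ (-γ)]
  simp_rw [key]
  rw [integral_const_mul, Measure.integral_comp_smul volume
    fun y : EuclideanSpace ℝ (Fin n) => (1 + ‖y‖ ^ 2) ^ (-γ), ← japaneseConst,
    finrank_euclideanSpace_fin, abs_of_pos (by positivity), smul_eq_mul]
  have h1 : (√(K / M) ^ n)⁻¹ = M ^ ((n : ℝ) / 2) * K ^ (-((n : ℝ) / 2)) := by
    rw [Real.sqrt_eq_rpow, ← Real.rpow_natCast, ← Real.rpow_mul hKM.le, ← Real.rpow_neg hKM.le,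
      Real.div_rpow hK.le hM.le, div_eq_mul_inv, ← Real.rpow_neg hM.le, mul_comm]
    congr 2 <;> ring
  rw [h1, sub_eq_add_neg, Real.rpow_add hM]
  ring

end Spatial

/-- The kernel `w^(p-1) (w a + Y)^(-γ)`, whose integrals over `w` and over `Y = ‖y‖²` are both
explicit. -/
noncomputable def stieltjesKernel (p γ a Y w : ℝ) : ℝ := w ^ (p - 1) * (w * a + Y) ^ (-γ)

section Kernel

variable {n : ℕ} {s p : ℝ}

lemma integral_stieltjesKernel_centered {A w b : ℝ} (hs : 0 < s) (hp : 0 < p) (hA : 0 < A)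
    (hw : 0 < w) (hb : 0 ≤ b) :
    Integrable (fun y : EuclideanSpace ℝ (Fin n) =>
      stieltjesKernel p (p + n / 2 + s) (A + b * ‖y‖ ^ 2) (‖y‖ ^ 2) w) ∧
    ∫ y : EuclideanSpace ℝ (Fin n),
      stieltjesKernel p (p + n / 2 + s) (A + b * ‖y‖ ^ 2) (‖y‖ ^ 2) w
      = japaneseConst n (p + n / 2 + s) *
        (w ^ (-s - 1) * ((1 + b * w) ^ (-((n : ℝ) / 2)) * A ^ (-(p + s)))) := by
  have key : ∀ y : EuclideanSpace ℝ (Fin n),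
      stieltjesKernel p (p + n / 2 + s) (A + b * ‖y‖ ^ 2) (‖y‖ ^ 2) w
      = w ^ (p - 1) * (w * A + (1 + b * w) * ‖y + 0‖ ^ 2) ^ (-(p + n / 2 + s)) := by
    intro y
    rw [stieltjesKernel, add_zero]
    ring_nf
  obtain ⟨h1, h2⟩ := integral_rpow_quadratic (n := n) (γ := p + n / 2 + s) (M := w * A)
    (K := 1 + b * w) (by linarith) (by positivity) (by positivity) 0
  simp_rw [key]
  refine ⟨h1.const_mul _, ?_⟩
  rw [integral_const_mul, h2, Real.mul_rpow hw.le hA.le]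
  have e : w ^ (p - 1) * w ^ ((n : ℝ) / 2 - (p + n / 2 + s)) = w ^ (-s - 1) := by
    rw [← Real.rpow_add hw]
    congr 1
    ring
  have e' : (n : ℝ) / 2 - (p + n / 2 + s) = -(p + s) := by ring
  rw [← e, e']
  ring

lemma integral_stieltjesKernel_translated {μ w : ℝ} (hs : 0 < s) (hp : 0 < p) (hμ : 0 < μ)
    (hw : 0 < w) (z : EuclideanSpace ℝ (Fin n)) :
    Integrable (fun y : EuclideanSpace ℝ (Fin n) =>
      stieltjesKernel p (p + n / 2 + s) (μ + ‖z + y‖ ^ 2) (‖y‖ ^ 2) w) ∧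
    ∫ y : EuclideanSpace ℝ (Fin n),
      stieltjesKernel p (p + n / 2 + s) (μ + ‖z + y‖ ^ 2) (‖y‖ ^ 2) w
      = japaneseConst n (p + n / 2 + s) *
        (w ^ (-s - 1) * ((1 + w) ^ (s + p - n / 2) * (μ * w + (μ + ‖z‖ ^ 2)) ^ (-(p + s)))) := by
  have key : ∀ y : EuclideanSpace ℝ (Fin n),
      stieltjesKernel p (p + n / 2 + s) (μ + ‖z + y‖ ^ 2) (‖y‖ ^ 2) w
      = w ^ (p - 1) * (w * (μ * w + (μ + ‖z‖ ^ 2)) * (1 + w)⁻¹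
        + (1 + w) * ‖y + (w / (1 + w)) • z‖ ^ 2) ^ (-(p + n / 2 + s)) := by
    intro y
    rw [stieltjesKernel, norm_add_sq_real, norm_add_sq_real, inner_smul_right, norm_smul, mul_pow,
      Real.norm_eq_abs, sq_abs, real_inner_comm y z]
    congr 2
    field_simp
    ring
  obtain ⟨h1, h2⟩ := integral_rpow_quadratic (n := n) (γ := p + n / 2 + s)
    (M := w * (μ * w + (μ + ‖z‖ ^ 2)) * (1 + w)⁻¹) (K := 1 + w) (by linarith) (by positivity)
    (by positivity) ((w / (1 + w)) • z)
  simp_rw [key]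
  refine ⟨h1.const_mul _, ?_⟩
  rw [integral_const_mul, h2, Real.mul_rpow (by positivity) (by positivity),
    Real.mul_rpow hw.le (by positivity)]
  have e : w ^ (p - 1) * w ^ ((n : ℝ) / 2 - (p + n / 2 + s)) = w ^ (-s - 1) := by
    rw [← Real.rpow_add hw]
    congr 1
    ring
  have e' : (n : ℝ) / 2 - (p + n / 2 + s) = -(p + s) := by ring
  have e'' : (1 + w)⁻¹ ^ (-(p + s)) * (1 + w) ^ (-((n : ℝ) / 2)) = (1 + w) ^ (s + p - n / 2) := by
    rw [Real.inv_rpow (by positivity), ← Real.rpow_neg (by positivity),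
      ← Real.rpow_add (by positivity)]
    congr 1
    ring
  rw [← e, ← e'', e']
  ring

lemma integral_stieltjesKernel_Ioi {a : ℝ} (hs : 0 < s) (hp : 0 < p) (ha : 0 < a)
    {y : EuclideanSpace ℝ (Fin n)} (hy : y ≠ 0) :
    IntegrableOn (stieltjesKernel p (p + n / 2 + s) a (‖y‖ ^ 2)) (Ioi 0) ∧
    ∫ w in Ioi (0 : ℝ), stieltjesKernel p (p + n / 2 + s) a (‖y‖ ^ 2) w
      = betaConst p (p + n / 2 + s) * (a ^ (-p) / ‖y‖ ^ ((n : ℝ) + 2 * s)) := by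
  have hy' : 0 < ‖y‖ := norm_pos_iff.2 hy
  have hn : (0 : ℝ) ≤ n := n.cast_nonneg
  obtain ⟨h1, h2⟩ := integral_rpow_mul_rpow_affine (p := p) (γ := p + n / 2 + s) (a := a)
    (Y := ‖y‖ ^ 2) hp (by linarith) ha (by positivity)
  refine ⟨h1, h2.trans ?_⟩
  rw [← Real.rpow_natCast, ← Real.rpow_mul hy'.le, div_eq_mul_inv (a ^ (-p)),
    ← Real.rpow_neg hy'.le, mul_assoc]
  congr 3
  push_cast
  ring

end Kernel

section Barrier

variable {n : ℕ} {s p : ℝ}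

lemma rpow_affine_rpow_affine_bounds {κ β μ A w : ℝ} (hβ : 0 ≤ β) (hμ : 0 ≤ μ)
    (hA : 0 < A) (hw : 0 ≤ w) :
    0 ≤ (1 + w) ^ κ * (μ * w + A) ^ (-β) ∧
      (1 + w) ^ κ * (μ * w + A) ^ (-β) ≤ A ^ (-β) * (1 + w) ^ κ := by
  refine ⟨by positivity, ?_⟩
  rw [mul_comm]
  have : (μ * w + A) ^ (-β) ≤ A ^ (-β) :=
    Real.rpow_le_rpow_of_nonpos hA (by nlinarith [mul_nonneg hμ hw]) (by linarith)
  gcongr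

/-- Integrability, against `w ^ (-s - 1)`, of a difference of two powers agreeing at the origin. -/
lemma integrableOn_rpow_mul_sub {κ β μ A q ν : ℝ} (hs1 : s < 1) (hκ : 0 ≤ κ)
    (hκs : κ < s) (hβ : 0 ≤ β) (hμ : 0 ≤ μ) (hA : 0 < A) (hq : 0 ≤ q) (hν : 0 ≤ ν) :
    IntegrableOn (fun w : ℝ => w ^ (-s - 1) *
      ((1 + w) ^ κ * (μ * w + A) ^ (-β) - (1 + ν * w) ^ (-q) * A ^ (-β))) (Ioi 0) := by
  refine integrableOn_rpow_mul_of_growth (C := A ^ (-β)) hs1 hκ hκs ?_ (by simp) ?_ ?_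
  · have h1 : ∀ w ∈ Ioi (0 : ℝ), 1 + w ≠ 0 := fun w (hw : 0 < w) => by positivity
    have h2 : ∀ w ∈ Ioi (0 : ℝ), μ * w + A ≠ 0 := fun w (hw : 0 < w) => by positivity
    have h3 : ∀ w ∈ Ioi (0 : ℝ), 1 + ν * w ≠ 0 := fun w (hw : 0 < w) => by positivity
    refine ContinuousOn.sub (ContinuousOn.mul ?_ ?_) (ContinuousOn.mul ?_ continuousOn_const)
    · exact ContinuousOn.rpow_const (by fun_prop) fun w hw => Or.inl (h1 w hw)
    · exact ContinuousOn.rpow_const (by fun_prop) fun w hw => Or.inl (h2 w hw)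
    · exact ContinuousOn.rpow_const (by fun_prop) fun w hw => Or.inl (h3 w hw)
  · refine DifferentiableAt.sub (DifferentiableAt.mul ?_ ?_) (DifferentiableAt.mul ?_ (by fun_prop))
    · exact DifferentiableAt.rpow_const (by fun_prop) (Or.inl (by norm_num))
    · exact DifferentiableAt.rpow_const (by fun_prop) (Or.inl (by simpa using hA.ne'))
    · exact DifferentiableAt.rpow_const (by fun_prop) (Or.inl (by norm_num))
  · intro w hw
    obtain ⟨h1, h2⟩ := rpow_affine_rpow_affine_bounds hβ hμ hA hw (κ := κ)
    have h3 : 0 ≤ (1 + ν * w) ^ (-q) * A ^ (-β) := by positivity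
    have h4 : (1 + ν * w) ^ (-q) * A ^ (-β) ≤ A ^ (-β) * (1 + w) ^ κ := by
      rw [mul_comm]
      gcongr
      exact (Real.rpow_le_one_of_one_le_of_nonpos (by nlinarith [mul_nonneg hν hw])
        (by linarith)).trans (Real.one_le_rpow (by linarith) hκ)
    rw [abs_le]
    constructor <;> linarith

lemma integral_add_sub_two_mul {α : Type*} [MeasurableSpace α] {ν : Measure α} {f g h : α → ℝ}
    (hf : Integrable f ν) (hg : Integrable g ν) (hh : Integrable h ν) :
    ∫ a, f a + g a - 2 * h a ∂ν = ∫ a, f a ∂ν + ∫ a, g a ∂ν - 2 * ∫ a, h a ∂ν := by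
  rw [← integral_const_mul, ← integral_add hf hg]
  exact integral_sub (hf.add hg) (hh.const_mul 2)

/-- Joint integrability of a nonnegative function on `ℝⁿ × (0, ∞)` whose slice integrals are
known. -/
lemma integrable_prod_of_slice {G : EuclideanSpace ℝ (Fin n) × ℝ → ℝ} {g : ℝ → ℝ}
    (hm : Measurable G) (h0 : ∀ y, ∀ w ∈ Ioi (0 : ℝ), 0 ≤ G (y, w))
    (hi : ∀ w ∈ Ioi (0 : ℝ), Integrable fun y => G (y, w))
    (hv : ∀ w ∈ Ioi (0 : ℝ), ∫ y, G (y, w) = g w) (hg : IntegrableOn g (Ioi 0)) :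
    Integrable G ((volume : Measure (EuclideanSpace ℝ (Fin n))).prod
      (volume.restrict (Ioi 0))) := by
  rw [integrable_prod_iff' hm.aestronglyMeasurable]
  refine ⟨(ae_restrict_iff' measurableSet_Ioi).2 (ae_of_all _ hi), ?_⟩
  refine IntegrableOn.congr_fun hg (fun w hw => ?_) measurableSet_Ioi
  rw [← hv w hw]
  exact integral_congr_ae (ae_of_all _ fun y => (Real.norm_of_nonneg (h0 y w hw)).symm)

/-- The fractional Laplacian of `(μ + ‖x‖²)^(-p)` as a one-dimensional integral. -/
theorem fracLap_rpow_add_norm_sq {μ : ℝ} (hn : 0 < n) (hs : 0 < s) (hs1 : s < 1) (hp : 0 < p)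
    (hκ : (n : ℝ) / 2 ≤ s + p) (hpn : p < n / 2) (hμ : 0 < μ) (x : EuclideanSpace ℝ (Fin n)) :
    fracLap n s (fun z => (μ + ‖z‖ ^ 2) ^ (-p)) x =
      -(japaneseConst n (p + n / 2 + s) / betaConst p (p + n / 2 + s)) *
        ∫ w in Ioi (0 : ℝ), w ^ (-s - 1) * ((1 + w) ^ (s + p - n / 2)
          * (μ * w + (μ + ‖x‖ ^ 2)) ^ (-(p + s)) - (μ + ‖x‖ ^ 2) ^ (-(p + s))) := by
  set γ : ℝ := p + n / 2 + s with hγ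
  set A : ℝ := μ + ‖x‖ ^ 2 with hA
  have hA0 : 0 < A := by positivity
  have hn0 : (0 : ℝ) < n := by exact_mod_cast hn
  have hγ0 : 0 < γ := by positivity
  have hB : 0 < betaConst p γ := betaConst_pos hp (by rw [hγ]; linarith)
  let F₁ : EuclideanSpace ℝ (Fin n) × ℝ → ℝ := fun z =>
    stieltjesKernel p γ (μ + ‖x + z.1‖ ^ 2) (‖z.1‖ ^ 2) z.2
  let F₂ : EuclideanSpace ℝ (Fin n) × ℝ → ℝ := fun z =>
    stieltjesKernel p γ (μ + ‖-x + z.1‖ ^ 2) (‖z.1‖ ^ 2) z.2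
  let F₀ : EuclideanSpace ℝ (Fin n) × ℝ → ℝ := fun z =>
    stieltjesKernel p γ (A + 0 * ‖z.1‖ ^ 2) (‖z.1‖ ^ 2) z.2
  let Fc : EuclideanSpace ℝ (Fin n) × ℝ → ℝ := fun z =>
    stieltjesKernel p γ (A + 1 * ‖z.1‖ ^ 2) (‖z.1‖ ^ 2) z.2
  have m₁ : Measurable F₁ := by
    simp only [F₁, stieltjesKernel]
    fun_prop
  have m₂ : Measurable F₂ := by
    simp only [F₂, stieltjesKernel]
    fun_prop
  have m₀ : Measurable F₀ := by
    simp only [F₀, stieltjesKernel]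
    fun_prop
  have mc : Measurable Fc := by
    simp only [Fc, stieltjesKernel]
    fun_prop
  have i₁ : ∀ w ∈ Ioi (0 : ℝ), _ := fun w (hw : 0 < w) =>
    integral_stieltjesKernel_translated (n := n) hs hp hμ hw x
  have i₂ : ∀ w ∈ Ioi (0 : ℝ), _ := fun w (hw : 0 < w) =>
    integral_stieltjesKernel_translated (n := n) hs hp hμ hw (-x)
  have i₀ : ∀ w ∈ Ioi (0 : ℝ), _ := fun w (hw : 0 < w) =>
    integral_stieltjesKernel_centered (n := n) hs hp hA0 hw le_rfl
  have ic : ∀ w ∈ Ioi (0 : ℝ), _ := fun w (hw : 0 < w) =>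
    integral_stieltjesKernel_centered (n := n) hs hp hA0 hw zero_le_one
  simp only [norm_neg, ← hγ, ← hA] at i₁ i₂ i₀ ic
  set J : ℝ := japaneseConst n γ with hJ
  -- the convexity gap and the radial gap are nonnegative with integrable slices
  have hG₁ : Integrable (fun z => F₁ z + F₂ z - 2 * Fc z)
      ((volume : Measure (EuclideanSpace ℝ (Fin n))).prod (volume.restrict (Ioi 0))) := by
    refine integrable_prod_of_slice (g := fun w => (2 * J) * (w ^ (-s - 1) *
      ((1 + w) ^ (s + p - n / 2) * (μ * w + A) ^ (-(p + s))
        - (1 + 1 * w) ^ (-((n : ℝ) / 2)) * A ^ (-(p + s))))) (by fun_prop) ?_ ?_ ?_ ?_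
    · intro y w hw
      have hw' : (0 : ℝ) < w := hw
      have hpar : (w * (μ + ‖x + y‖ ^ 2) + ‖y‖ ^ 2 + (w * (μ + ‖-x + y‖ ^ 2) + ‖y‖ ^ 2)) / 2
          = w * (A + 1 * ‖y‖ ^ 2) + ‖y‖ ^ 2 := by
        rw [norm_add_sq_real, norm_add_sq_real, inner_neg_left, norm_neg]
        ring
      have := rpow_neg_midpoint_le (γ := γ) (a := w * (μ + ‖x + y‖ ^ 2) + ‖y‖ ^ 2)
        (b := w * (μ + ‖-x + y‖ ^ 2) + ‖y‖ ^ 2) hγ0.le (by positivity) (by positivity)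
      rw [hpar] at this
      simp only [F₁, F₂, Fc, stieltjesKernel]
      have hwp : 0 ≤ w ^ (p - 1) := by positivity
      nlinarith [mul_le_mul_of_nonneg_left this hwp]
    · exact fun w hw => ((i₁ w hw).1.add (i₂ w hw).1).sub ((ic w hw).1.const_mul 2)
    · intro w hw
      simp only [F₁, F₂, Fc]
      rw [integral_add_sub_two_mul (i₁ w hw).1 (i₂ w hw).1 (ic w hw).1, (i₁ w hw).2, (i₂ w hw).2,
        (ic w hw).2]
      ring
    · exact (integrableOn_rpow_mul_sub hs1 (by linarith) (by linarith) (by linarith) hμ.le hA0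
        (by positivity) zero_le_one).const_mul _
  have hG₂ : Integrable (fun z => 2 * F₀ z - 2 * Fc z)
      ((volume : Measure (EuclideanSpace ℝ (Fin n))).prod (volume.restrict (Ioi 0))) := by
    refine integrable_prod_of_slice (g := fun w => (2 * J) * (w ^ (-s - 1) *
      ((1 + w) ^ (0 : ℝ) * (0 * w + A) ^ (-(p + s))
        - (1 + 1 * w) ^ (-((n : ℝ) / 2)) * A ^ (-(p + s))))) (by fun_prop) ?_ ?_ ?_ ?_
    · intro y w hw
      have hw' : (0 : ℝ) < w := hw
      simp only [F₀, Fc, stieltjesKernel]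
      have : (w * (A + 1 * ‖y‖ ^ 2) + ‖y‖ ^ 2) ^ (-γ)
          ≤ (w * (A + 0 * ‖y‖ ^ 2) + ‖y‖ ^ 2) ^ (-γ) := by
        refine Real.rpow_le_rpow_of_nonpos (by positivity) ?_ (by linarith)
        gcongr
        norm_num
      have hwp : 0 ≤ w ^ (p - 1) := by positivity
      nlinarith [mul_le_mul_of_nonneg_left this hwp]
    · exact fun w hw => ((i₀ w hw).1.const_mul 2).sub ((ic w hw).1.const_mul 2)
    · intro w hw
      simp only [F₀, Fc]
      rw [integral_sub ((i₀ w hw).1.const_mul 2) ((ic w hw).1.const_mul 2), integral_const_mul,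
        integral_const_mul, (i₀ w hw).2, (ic w hw).2]
      simp only [zero_mul, add_zero, zero_add, Real.rpow_zero, Real.one_rpow]
      ring
    · exact (integrableOn_rpow_mul_sub hs1 le_rfl hs (by linarith) le_rfl hA0
        (by positivity) zero_le_one).const_mul _
  have hD : Integrable (Function.uncurry fun y w => F₁ (y, w) + F₂ (y, w) - 2 * F₀ (y, w))
      ((volume : Measure (EuclideanSpace ℝ (Fin n))).prod (volume.restrict (Ioi 0))) := by
    refine (hG₁.sub hG₂).congr (ae_of_all _ fun z => ?_)
    simp only [Pi.sub_apply, Function.uncurry]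
    ring
  have hswap := integral_integral_swap hD
  have hleft : ∫ y, ∫ w in Ioi (0 : ℝ), F₁ (y, w) + F₂ (y, w) - 2 * F₀ (y, w)
      = betaConst p γ * ∫ y : EuclideanSpace ℝ (Fin n), ((μ + ‖x + y‖ ^ 2) ^ (-p)
        + (μ + ‖x - y‖ ^ 2) ^ (-p) - 2 * (μ + ‖x‖ ^ 2) ^ (-p)) / ‖y‖ ^ ((n : ℝ) + 2 * s) := by
    have : Nonempty (Fin n) := ⟨⟨0, hn⟩⟩
    rw [← integral_const_mul]
    refine integral_congr_ae ?_
    filter_upwards [compl_mem_ae_iff.2 (measure_singleton (0 : EuclideanSpace ℝ (Fin n)))] with y hy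
    have hy' : y ≠ 0 := hy
    obtain ⟨a₁, b₁⟩ := integral_stieltjesKernel_Ioi (n := n) (a := μ + ‖x + y‖ ^ 2) hs hp
      (by positivity) hy'
    obtain ⟨a₂, b₂⟩ := integral_stieltjesKernel_Ioi (n := n) (a := μ + ‖-x + y‖ ^ 2) hs hp
      (by positivity) hy'
    obtain ⟨a₀, b₀⟩ := integral_stieltjesKernel_Ioi (n := n) (a := A + 0 * ‖y‖ ^ 2) hs hp
      (by positivity) hy'
    rw [← hγ] at a₁ b₁ a₂ b₂ a₀ b₀
    simp only [F₁, F₂, F₀]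
    rw [integral_add_sub_two_mul a₁ a₂ a₀, b₁, b₂, b₀, zero_mul, add_zero,
      neg_add_eq_sub, norm_sub_rev y x]
    ring
  have hright : ∫ w in Ioi (0 : ℝ), ∫ y, F₁ (y, w) + F₂ (y, w) - 2 * F₀ (y, w)
      = (2 * J) * ∫ w in Ioi (0 : ℝ), w ^ (-s - 1) * ((1 + w) ^ (s + p - n / 2)
          * (μ * w + A) ^ (-(p + s)) - A ^ (-(p + s))) := by
    rw [← integral_const_mul]
    refine setIntegral_congr_fun measurableSet_Ioi fun w hw => ?_
    simp only [F₁, F₂, F₀]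
    rw [integral_add_sub_two_mul (i₁ w hw).1 (i₂ w hw).1 (i₀ w hw).1, (i₁ w hw).2, (i₂ w hw).2,
      (i₀ w hw).2]
    simp only [zero_mul, add_zero, Real.one_rpow]
    ring
  rw [hleft, hright] at hswap
  rw [fracLap, eq_div_of_mul_eq hB.ne' ((mul_comm _ _).trans hswap)]
  ring

/-- Positivity of the one-dimensional integral when `μ` is small compared with `A`. -/
lemma exists_forall_integral_pos {κ β : ℝ} (hs1 : s < 1) (hκ : 0 < κ) (hκs : κ < s) (hβ : 0 ≤ β) :
    ∃ ε₀ > 0, ∀ μ A : ℝ, 0 < μ → 0 < A → μ ≤ ε₀ * A →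
      0 < ∫ w in Ioi (0 : ℝ), w ^ (-s - 1) *
        ((1 + w) ^ κ * (μ * w + A) ^ (-β) - A ^ (-β)) := by
  have hlim : Tendsto (fun ε : ℝ => ∫ w in Ioi (0 : ℝ), w ^ (-s - 1) *
      ((1 + w) ^ κ * (ε * w + 1) ^ (-β) - 1)) (𝓝[>] 0)
      (𝓝 (∫ w in Ioi (0 : ℝ), w ^ (-s - 1) * ((1 + w) ^ κ - 1))) := by
    have hbi := integrableOn_rpow_mul_sub (μ := 0) (A := 1) (β := 0) (q := β) (ν := 1)
      hs1 hκ.le hκs le_rfl le_rfl one_pos hβ zero_le_one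
    refine tendsto_integral_filter_of_dominated_convergence _ ?_ ?_ hbi ?_
    · refine Eventually.of_forall fun ε => Measurable.aestronglyMeasurable ?_
      fun_prop
    · filter_upwards [Ioo_mem_nhdsGT (zero_lt_one' ℝ)] with ε hε
      refine (ae_restrict_iff' measurableSet_Ioi).2 (ae_of_all _ fun w hw => ?_)
      have hw' : (0 : ℝ) < w := hw
      have hε0 : 0 < ε := hε.1
      have hε1 : ε < 1 := hε.2
      have hwp : 0 ≤ w ^ (-s - 1) := by positivity
      rw [norm_mul, Real.norm_of_nonneg hwp]
      refine mul_le_mul_of_nonneg_left ?_ hwp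
      simp only [neg_zero, Real.rpow_zero, mul_one, one_mul, zero_mul]
      have h1 : 1 ≤ (1 + w) ^ κ := Real.one_le_rpow (by linarith) hκ.le
      have h2 : (ε * w + 1) ^ (-β) ≤ 1 :=
        Real.rpow_le_one_of_one_le_of_nonpos (by nlinarith) (by linarith)
      have h3 : (1 + w) ^ (-β) ≤ (ε * w + 1) ^ (-β) :=
        Real.rpow_le_rpow_of_nonpos (by positivity) (by nlinarith) (by linarith)
      have h4 : 0 ≤ (1 + w) ^ (-β) := by positivity
      have h5 : (1 + w) ^ (-β) ≤ 1 := h3.trans h2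
      rw [Real.norm_eq_abs, abs_le]
      constructor <;> nlinarith
    · refine (ae_restrict_iff' measurableSet_Ioi).2 (ae_of_all _ fun w _ => ?_)
      have hc : ContinuousAt (fun ε : ℝ => w ^ (-s - 1) *
          ((1 + w) ^ κ * (ε * w + 1) ^ (-β) - 1)) 0 := by
        refine continuousAt_const.mul ((continuousAt_const.mul ?_).sub continuousAt_const)
        exact ContinuousAt.rpow_const (by fun_prop) (Or.inl (by simp))
      have := hc.tendsto.mono_left (nhdsWithin_le_nhds (s := Ioi 0))
      simpa using this
  have hpos : 0 < ∫ w in Ioi (0 : ℝ), w ^ (-s - 1) * ((1 + w) ^ κ - 1) := by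
    refine setIntegral_Ioi_pos (fun w hw => ?_) ?_
    · have hw' : (0 : ℝ) < w := hw
      have : 1 < (1 + w) ^ κ := Real.one_lt_rpow (by linarith) hκ
      exact mul_pos (by positivity) (by linarith)
    · simpa using integrableOn_rpow_mul_sub (μ := 0) (A := 1) (β := 0) (q := 0) (ν := 0)
        hs1 hκ.le hκs le_rfl le_rfl one_pos le_rfl le_rfl
  obtain ⟨ε₁, hε₁, hsub⟩ := mem_nhdsGT_iff_exists_Ioo_subset.1 (hlim.eventually_const_lt hpos)
  have hε₁' : (0 : ℝ) < ε₁ := hε₁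
  refine ⟨ε₁ / 2, by positivity, fun μ A hμ hA hle => ?_⟩
  have hmem : μ / A ∈ Ioo 0 ε₁ :=
    ⟨by positivity, by rw [div_lt_iff₀ hA]; nlinarith⟩
  have hμA := hsub hmem
  have heq : ∀ w ∈ Ioi (0 : ℝ), w ^ (-s - 1) * ((1 + w) ^ κ * (μ * w + A) ^ (-β) - A ^ (-β))
      = A ^ (-β) * (w ^ (-s - 1) * ((1 + w) ^ κ * (μ / A * w + 1) ^ (-β) - 1)) := by
    intro w hw
    have hw' : (0 : ℝ) < w := hw
    have e : μ * w + A = A * (μ / A * w + 1) := by field_simp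
    rw [e, Real.mul_rpow hA.le (by positivity)]
    ring
  rw [setIntegral_congr_fun measurableSet_Ioi heq, integral_const_mul]
  exact mul_pos (by positivity) hμA

lemma fracLap_mul_sub_const (u : EuclideanSpace ℝ (Fin n) → ℝ) (a b : ℝ)
    (x : EuclideanSpace ℝ (Fin n)) :
    fracLap n s (fun z => a * u z - b) x = a * fracLap n s u x := by
  rw [fracLap, fracLap, mul_left_comm a, ← integral_const_mul a]
  congr 1
  refine integral_congr_ae (ae_of_all _ fun y => ?_)
  ring

/-- Comparison with a subsolution outside a ball which tends to zero at infinity. -/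
lemma ViscSupersol.comparison {u φ : EuclideanSpace ℝ (Fin n) → ℝ} {a R : ℝ} (ha : 0 < a)
    (hu0 : ∀ x, 0 ≤ u x) (hu : ViscSupersol n s (fun _ => 0) u) (hφ : ContDiff ℝ 2 φ)
    (hφ0 : Tendsto φ (cocompact _) (𝓝 0)) (hin : ∀ x, ‖x‖ ≤ R → a * φ x ≤ u x)
    (hout : ∀ x, R < ‖x‖ → fracLap n s φ x < 0) (x : EuclideanSpace ℝ (Fin n)) :
    a * φ x ≤ u x := by
  by_contra! hlt
  have hcont : Continuous fun y => u y - a * φ y := hu.1.sub (hφ.continuous.const_mul a)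
  obtain ⟨x₀, hx₀⟩ : ∃ x₀, ∀ y, u x₀ - a * φ x₀ ≤ u y - a * φ y := by
    refine hcont.exists_forall_le' x ?_
    have h1 : Tendsto (fun y => a * φ y) (cocompact _) (𝓝 0) := by simpa using hφ0.const_mul a
    filter_upwards [h1.eventually_lt_const (sub_pos.2 hlt)] with y hy
    linarith [hu0 y]
  have hneg : u x₀ - a * φ x₀ < 0 := (hx₀ x).trans_lt (by linarith)
  have hR : R < ‖x₀‖ := by
    by_contra! h
    linarith [hin x₀ h]
  have htest := hu.2 x₀ (fun z => a * φ z - (a * φ x₀ - u x₀))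
    ((contDiff_const.mul hφ).sub contDiff_const) (by ring) (fun y => by linarith [hx₀ y])
  rw [fracLap_mul_sub_const] at htest
  nlinarith [hout x₀ hR]

end Barrier

/-- lower bound `m_u(r) ≥ C m_u(R₀) r^σ` for nonnegative nontrivial
viscosity super-solutions of `(-Δ)^s u = 0` in ℝⁿ (Lemma 2.1). -/
theorem stmt_10 (n : ℕ) (s : ℝ) (hn : 2 ≤ n) (hs : 0 < s) (hs1 : s < 1)
    (hns : 2 * s < (n : ℝ)) :
    ∀ R₀ : ℝ, 1 < R₀ → ∀ σ : ℝ, σ ∈ Set.Ioo (-(n : ℝ)) (-(n : ℝ) + 2 * s) →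
    ∃ C > 0, ∀ u : EuclideanSpace ℝ (Fin n) → ℝ,
      (∀ x, 0 ≤ u x) → u ≠ 0 → ViscSupersol n s (fun _ => 0) u →
      ∀ r : ℝ, R₀ ≤ r →
        C * sInf (u '' Metric.closedBall 0 R₀) * r ^ σ ≤ sInf (u '' Metric.closedBall 0 r) := by
  intro R₀ hR₀ σ hσ
  obtain ⟨hσ1, hσ2⟩ := hσ
  have hn' : (2 : ℝ) ≤ n := by exact_mod_cast hn
  set p : ℝ := -σ / 2 with hp_def
  have hp : 0 < p := by rw [hp_def]; linarith
  obtain ⟨ε₀, hε₀, hpos⟩ := exists_forall_integral_pos (s := s) (κ := s + p - n / 2) (β := p + s)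
    hs1 (by rw [hp_def]; linarith) (by rw [hp_def]; linarith) (by linarith)
  set μ : ℝ := min 1 ε₀ with hμ_def
  have hμ : 0 < μ := lt_min one_pos hε₀
  have hμ1 : μ ≤ 1 := min_le_left _ _
  refine ⟨μ ^ p * 2 ^ (-p), by positivity, fun u hu0 _ hu r hr => ?_⟩
  set m : ℝ := sInf (u '' Metric.closedBall 0 R₀) with hm
  have hbdd : ∀ ρ : ℝ, BddBelow (u '' Metric.closedBall 0 ρ) := fun ρ =>
    ⟨0, by rintro _ ⟨x, _, rfl⟩; exact hu0 x⟩
  have hm0 : 0 ≤ m := Real.sInf_nonneg (by rintro _ ⟨x, _, rfl⟩; exact hu0 x)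
  have hr0 : 0 < r := by linarith
  refine le_csInf ⟨u 0, 0, Metric.mem_closedBall_self hr0.le, rfl⟩ ?_
  rintro _ ⟨x, hx, rfl⟩
  rw [mem_closedBall_zero_iff] at hx
  rcases hm0.eq_or_lt with h0 | hmpos
  · rw [← h0]
    simpa using hu0 x
  have hcmp : m * μ ^ p * (μ + ‖x‖ ^ 2) ^ (-p) ≤ u x := by
    refine hu.comparison (φ := fun z => (μ + ‖z‖ ^ 2) ^ (-p)) (R := R₀) (by positivity) hu0
      ?_ ?_ ?_ ?_ x
    · exact ContDiff.rpow_const_of_ne (contDiff_const.add (contDiff_norm_sq ℝ))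
        fun z => by positivity
    · refine (tendsto_rpow_neg_atTop hp).comp (tendsto_atTop_add_const_left _ _ ?_)
      exact (tendsto_pow_atTop two_ne_zero).comp (tendsto_norm_cocompact_atTop)
    · intro z hz
      have h1 : (μ + ‖z‖ ^ 2) ^ (-p) ≤ μ ^ (-p) :=
        Real.rpow_le_rpow_of_nonpos hμ (by nlinarith [sq_nonneg ‖z‖]) (by linarith)
      have h2 : μ ^ p * μ ^ (-p) = 1 := by
        rw [← Real.rpow_add hμ]
        simp
      calc m * μ ^ p * (μ + ‖z‖ ^ 2) ^ (-p) ≤ m * μ ^ p * μ ^ (-p) := by gcongr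
        _ = m := by rw [mul_assoc, h2, mul_one]
        _ ≤ u z := csInf_le (hbdd R₀) ⟨z, mem_closedBall_zero_iff.2 hz, rfl⟩
    · intro z hz
      rw [fracLap_rpow_add_norm_sq (by omega) hs hs1 hp (by rw [hp_def]; linarith)
        (by rw [hp_def]; linarith) hμ z, neg_mul, neg_lt_zero]
      have hJ : 0 < japaneseConst n (p + n / 2 + s) := japaneseConst_pos (by linarith)
      have hB : 0 < betaConst p (p + n / 2 + s) := betaConst_pos hp (by linarith)
      refine mul_pos (by positivity) (hpos μ _ hμ (by positivity) ?_)
      have h1 : 1 ≤ μ + ‖z‖ ^ 2 := by nlinarith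
      calc μ ≤ ε₀ := min_le_right _ _
        _ ≤ ε₀ * (μ + ‖z‖ ^ 2) := le_mul_of_one_le_right hε₀.le h1
  have hrσ : 2 ^ (-p) * r ^ σ ≤ (μ + ‖x‖ ^ 2) ^ (-p) := by
    have e : r ^ σ = (r ^ 2) ^ (-p) := by
      rw [← Real.rpow_natCast, ← Real.rpow_mul hr0.le, hp_def]
      congr 1
      push_cast
      ring
    rw [e, ← Real.mul_rpow (by norm_num) (by positivity)]
    exact Real.rpow_le_rpow_of_nonpos (by positivity) (by nlinarith [norm_nonneg x]) (by linarith)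
  calc μ ^ p * 2 ^ (-p) * m * r ^ σ = m * μ ^ p * (2 ^ (-p) * r ^ σ) := by ring
    _ ≤ m * μ ^ p * (μ + ‖x‖ ^ 2) ^ (-p) := by gcongr
    _ ≤ u x := hcmp
end

section
/- Let 0 < s < 1 and n > 2s, and define Θ(x) = log(1+|x|)·|x|^{−n+2s} for x ≠ 0. Then there exists a constant C₀ > 0 such that (−Δ)^s Θ(x) ≤ C₀ |x|^{−n} for all x ≠ 0. -/
open MeasureTheory

open Set Metric Filter Topology Module

section Inversion

variable {E : Type*} [NormedAddCommGroup E] [InnerProductSpace ℝ E]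

theorem abs_det_smul_reflection [FiniteDimensional ℝ E] (K : Submodule ℝ E) {c : ℝ} (hc : 0 ≤ c) :
    |(c • (K.reflection : E →L[ℝ] E)).det| = c ^ finrank ℝ E := by
  have h : ((K.reflection : E →L[ℝ] E) : E →ₗ[ℝ] E) = K.reflection.toLinearMap := rfl
  rw [ContinuousLinearMap.det, ContinuousLinearMap.toLinearMap_smul, LinearMap.det_smul, h,
    K.det_reflection, abs_mul, abs_pow, abs_pow, abs_neg, abs_one, one_pow, mul_one,
    abs_of_nonneg hc]

theorem norm_inversion_zero (w : E) : ‖EuclideanGeometry.inversion 0 1 w‖ = ‖w‖⁻¹ := by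
  simpa using EuclideanGeometry.dist_inversion_center 0 w 1

theorem norm_inversion_sub_of_norm_eq_one {e w : E} (he : ‖e‖ = 1) (hw : w ≠ 0) :
    ‖EuclideanGeometry.inversion 0 1 w - e‖ = ‖w - e‖ / ‖w‖ := by
  have he0 : e ≠ 0 := by rintro rfl; simp at he
  have h := EuclideanGeometry.dist_inversion_inversion hw he0 1
  rw [EuclideanGeometry.inversion_of_mem_sphere (x := e) (by simpa using he)] at h
  simp only [dist_eq_norm, sub_zero, he] at h
  rw [h]; ring

end Inversion

section Radial

variable {E : Type*} [NormedAddCommGroup E] [NormedSpace ℝ E] [FiniteDimensional ℝ E]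
  [MeasurableSpace E] [BorelSpace E] (μ : Measure E) [μ.IsAddHaarMeasure]

theorem integrableOn_ball_norm_rpow [Nontrivial E] {a R : ℝ} (ha : -(finrank ℝ E : ℝ) < a)
    (hR : 0 < R) : IntegrableOn (fun x : E => ‖x‖ ^ a) (ball 0 R) μ := by
  have hd : 1 ≤ finrank ℝ E := finrank_pos
  rw [integrableOn_fun_norm_addHaar μ (f := fun t => t ^ a)]
  have h := (intervalIntegral.integrableOn_Ioo_rpow_iff (s := (finrank ℝ E : ℝ) - 1 + a) hR).2
    (by linarith)
  refine h.congr_fun (fun t ht => ?_) measurableSet_Ioo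
  simp only [smul_eq_mul]
  rw [Real.rpow_add ht.1, ← Nat.cast_one, ← Nat.cast_sub hd, Real.rpow_natCast]

theorem integrableOn_norm_rpow_compl_ball {a ε : ℝ} (ha : a < -(finrank ℝ E : ℝ)) (hε : 0 < ε) :
    IntegrableOn (fun x : E => ‖x‖ ^ a) {x | ε < ‖x‖} μ := by
  have h := (integrable_one_add_norm (μ := μ) (E := E) (r := -a) (by linarith)).const_mul
    ((1 + ε⁻¹) ^ (-a))
  refine h.integrableOn.mono' (measurable_norm.pow_const a).aestronglyMeasurable ?_
  refine (ae_restrict_iff' (measurableSet_lt measurable_const measurable_norm)).2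
    (ae_of_all _ fun x hx => ?_)
  have hx : ε < ‖x‖ := hx
  have hx0 : 0 < ‖x‖ := hε.trans hx
  rw [Real.norm_of_nonneg (by positivity), neg_neg, Real.rpow_neg (by positivity),
    ← Real.inv_rpow (by positivity), ← Real.mul_rpow (by positivity) (by positivity)]
  refine Real.rpow_le_rpow_of_nonpos (by positivity) ?_
    (ha.le.trans (neg_nonpos.2 (Nat.cast_nonneg _)))
  rw [inv_mul_le_iff₀ (by positivity)]
  have : 1 ≤ ε⁻¹ * ‖x‖ := by rw [← div_eq_inv_mul, one_le_div hε]; exact hx.le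
  linarith

end Radial

theorem neg_log_le_of_half_le {ρ : ℝ} (h1 : 1 / 2 ≤ ρ) (h2 : ρ ≤ 1) :
    -Real.log ρ ≤ 2 * (1 - ρ) := by
  have hρ : 0 < ρ := by linarith
  have hinv : ρ⁻¹ ≤ 2 := by rw [inv_le_comm₀ hρ two_pos]; linarith
  have h := Real.one_sub_inv_le_log_of_pos hρ
  have : ρ⁻¹ - 1 = ρ⁻¹ * (1 - ρ) := by field_simp
  nlinarith

theorem rpow_neg_sub_one_le {α ρ : ℝ} (hα : 0 ≤ α) (h1 : 1 / 2 ≤ ρ) (h2 : ρ ≤ 1) :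
    ρ ^ (-α) - 1 ≤ α * 2 ^ α * 2 * (1 - ρ) := by
  have hρ : 0 < ρ := by linarith
  have hinv : ρ⁻¹ ≤ 2 := by rw [inv_le_comm₀ hρ two_pos]; linarith
  have hlog0 : 0 ≤ -Real.log ρ := by linarith [Real.log_nonpos hρ.le h2]
  have hlog : -Real.log ρ ≤ 2 * (1 - ρ) := neg_log_le_of_half_le h1 h2
  have hexp : ρ ^ (-α) - 1 ≤ ρ ^ (-α) * (α * -Real.log ρ) := by
    have h := Real.one_sub_inv_le_log_of_pos (Real.rpow_pos_of_pos hρ (-α))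
    have hp := Real.rpow_pos_of_pos hρ (-α)
    rw [Real.log_rpow hρ] at h
    have := mul_le_mul_of_nonneg_left h hp.le
    rw [mul_sub, mul_inv_cancel₀ hp.ne'] at this
    linarith
  have hle : ρ ^ (-α) ≤ 2 ^ α := by
    rw [Real.rpow_neg hρ.le, ← Real.inv_rpow hρ.le]
    exact Real.rpow_le_rpow (by positivity) hinv hα
  calc ρ ^ (-α) - 1 ≤ ρ ^ (-α) * (α * -Real.log ρ) := hexp
    _ ≤ 2 ^ α * (α * (2 * (1 - ρ))) := by gcongr
    _ = _ := by ring

/-- Convexity of `t ↦ log (1 + exp t)` controls the sum of the two reflected increments. -/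
theorem neg_defect_le_log_increments {α r ρ : ℝ} (hα : 0 ≤ α) (hr : 0 < r) (hρ : 0 < ρ)
    (hρ1 : ρ ≤ 1) :
    -((ρ ^ (-α) - 1) * -Real.log ρ) ≤
      (Real.log (1 + r * ρ) * ρ ^ (-α) - Real.log (1 + r)) +
        (Real.log (1 + r * ρ⁻¹) - Real.log (1 + r) * ρ ^ (-α)) := by
  have hp : 1 ≤ ρ ^ (-α) := Real.one_le_rpow_of_pos_of_le_one_of_nonpos hρ hρ1 (by linarith)
  have hconv : 2 * Real.log (1 + r) ≤ Real.log (1 + r * ρ) + Real.log (1 + r * ρ⁻¹) := by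
    rw [← Real.log_mul (by positivity) (by positivity), two_mul,
      ← Real.log_mul (by positivity) (by positivity)]
    refine Real.log_le_log (by positivity) ?_
    have h : 2 ≤ ρ + ρ⁻¹ := by
      have : ρ + ρ⁻¹ - 2 = (1 - ρ) ^ 2 * ρ⁻¹ := by field_simp; ring
      have : 0 ≤ (1 - ρ) ^ 2 * ρ⁻¹ := by positivity
      linarith
    have : (1 + r * ρ) * (1 + r * ρ⁻¹) = 1 + r * (ρ + ρ⁻¹) + r ^ 2 := by field_simp; ring
    nlinarith
  have hinc : Real.log (1 + r) - Real.log (1 + r * ρ) ≤ -Real.log ρ := by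
    have : Real.log ((1 + r) * ρ) ≤ Real.log (1 + r * ρ) :=
      Real.log_le_log (by positivity) (by nlinarith)
    rw [Real.log_mul (by positivity) hρ.ne'] at this
    linarith
  nlinarith

section LogRiesz

variable {E : Type*} [NormedAddCommGroup E]

/-- The radial profile `log (1 + r |z|) |z| ^ (-α)`. -/
noncomputable def logRiesz (α r : ℝ) (z : E) : ℝ :=
  Real.log (1 + r * ‖z‖) * ‖z‖ ^ (-α)

/-- The integrand `(Θ (z) - Θ (e)) / |z - e| ^ β` of the one-sided fractional difference quotient
of `Θ = logRiesz α r` at a unit vector `e`. -/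
noncomputable def logRieszQuotient (α β r : ℝ) (e z : E) : ℝ :=
  (logRiesz α r z - Real.log (1 + r)) / ‖z - e‖ ^ β

/-- The weight which dominates, uniformly in `r`, the negative part of the sum of
`logRieszQuotient` and of its pullback under inversion in the unit sphere. -/
noncomputable def inversionDefect (α β : ℝ) (e w : E) : ℝ :=
  (‖w‖ ^ (-α) - 1) * -Real.log ‖w‖ / ‖w - e‖ ^ β

theorem logRiesz_nonneg {α r : ℝ} (hr : 0 < r) (z : E) : 0 ≤ logRiesz α r z :=
  mul_nonneg (Real.log_nonneg (by nlinarith [norm_nonneg z])) (by positivity)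

theorem logRiesz_le_of_one_le {α r : ℝ} (hα : 0 < α) (hr : 0 < r) {z : E} (hz : 1 ≤ ‖z‖) :
    logRiesz α r z ≤ (1 + r) ^ α / α := by
  have hz0 : 0 < ‖z‖ := by linarith
  have h : Real.log (1 + r * ‖z‖) ≤ (1 + r) ^ α / α * ‖z‖ ^ α :=
    calc Real.log (1 + r * ‖z‖) ≤ (1 + r * ‖z‖) ^ α / α :=
          Real.log_le_rpow_div (by positivity) hα
      _ ≤ ((1 + r) * ‖z‖) ^ α / α := by
          gcongr; linarith
      _ = (1 + r) ^ α / α * ‖z‖ ^ α := by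
          rw [Real.mul_rpow (by positivity) (by positivity)]; ring
  rw [logRiesz, Real.rpow_neg hz0.le, ← div_eq_mul_inv, div_le_iff₀ (by positivity)]
  exact h

theorem logRiesz_le_of_le_one {α r : ℝ} (hr : 0 < r) {z : E} (hz : ‖z‖ ≤ 1) :
    logRiesz α r z ≤ Real.log (1 + r) * ‖z‖ ^ (-α) := by
  unfold logRiesz
  gcongr
  exact mul_le_of_le_one_right hr.le hz

theorem inversionDefect_nonneg {α β : ℝ} (hα : 0 ≤ α) {e w : E} (hw0 : w ≠ 0) (hw : ‖w‖ ≤ 1) :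
    0 ≤ inversionDefect α β e w := by
  have hρ : 0 < ‖w‖ := norm_pos_iff.2 hw0
  have hp : 1 ≤ ‖w‖ ^ (-α) :=
    Real.one_le_rpow_of_pos_of_le_one_of_nonpos hρ hw (by linarith)
  have hl := Real.log_nonpos hρ.le hw
  exact div_nonneg (mul_nonneg (by linarith) (by linarith)) (by positivity)

theorem one_sub_norm_le {e w : E} (he : ‖e‖ = 1) : 1 - ‖w‖ ≤ ‖w - e‖ := by
  have := norm_sub_norm_le e w
  rwa [he, norm_sub_rev] at this

theorem inversionDefect_le {α β a : ℝ} (hα : 0 ≤ α) (hβ : 0 ≤ β) (ha : 0 < a) {e w : E}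
    (he : ‖e‖ = 1) (hw0 : w ≠ 0) (hw : ‖w‖ < 1) :
    inversionDefect α β e w ≤
      2 ^ β / a * ‖w‖ ^ (-(α + a)) + α * 2 ^ α * 4 * ‖w - e‖ ^ (2 - β) := by
  have hρ : 0 < ‖w‖ := norm_pos_iff.2 hw0
  have hdist : 1 - ‖w‖ ≤ ‖w - e‖ := one_sub_norm_le he
  have hδ : 0 < ‖w - e‖ := by linarith
  have hl := Real.log_nonpos hρ.le hw.le
  have hp : 1 ≤ ‖w‖ ^ (-α) :=
    Real.one_le_rpow_of_pos_of_le_one_of_nonpos hρ hw.le (by linarith)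
  rcases lt_or_ge ‖w‖ (1 / 2) with h | h
  · have hlog : -Real.log ‖w‖ ≤ ‖w‖ ^ (-a) / a := by
      rw [← Real.log_inv, Real.rpow_neg hρ.le, ← Real.inv_rpow hρ.le]
      exact Real.log_le_rpow_div (by positivity) ha
    have hδ2 : (‖w - e‖ ^ β)⁻¹ ≤ 2 ^ β := by
      rw [← Real.inv_rpow hδ.le]
      refine Real.rpow_le_rpow (by positivity) ?_ hβ
      rw [inv_le_comm₀ hδ two_pos]
      linarith
    have h1 : inversionDefect α β e w ≤ 2 ^ β / a * ‖w‖ ^ (-(α + a)) :=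
      calc inversionDefect α β e w
          = (‖w‖ ^ (-α) - 1) * -Real.log ‖w‖ * (‖w - e‖ ^ β)⁻¹ := by
            rw [inversionDefect, div_eq_mul_inv]
        _ ≤ ‖w‖ ^ (-α) * (‖w‖ ^ (-a) / a) * 2 ^ β := by
            gcongr
            · linarith
            · linarith
        _ = 2 ^ β / a * ‖w‖ ^ (-(α + a)) := by
            rw [neg_add, Real.rpow_add hρ]; ring
    have : 0 ≤ α * 2 ^ α * 4 * ‖w - e‖ ^ (2 - β) := by positivity
    linarith
  · have hlog := neg_log_le_of_half_le h hw.le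
    have hpow := rpow_neg_sub_one_le hα h hw.le
    have h1 : inversionDefect α β e w ≤ α * 2 ^ α * 4 * ‖w - e‖ ^ (2 - β) :=
      calc inversionDefect α β e w
          ≤ (α * 2 ^ α * 2 * ‖w - e‖) * (2 * ‖w - e‖) / ‖w - e‖ ^ β := by
            unfold inversionDefect
            gcongr
            · linarith
            · exact hpow.trans (by gcongr)
            · exact hlog.trans (by gcongr)
        _ = α * 2 ^ α * 4 * ‖w - e‖ ^ (2 - β) := by
            rw [Real.rpow_sub hδ, Real.rpow_two]; ring
    have : 0 ≤ 2 ^ β / a * ‖w‖ ^ (-(α + a)) := by positivity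
    linarith

variable [MeasurableSpace E] [BorelSpace E]

theorem measurable_logRiesz (α r : ℝ) : Measurable (logRiesz α r : E → ℝ) := by
  unfold logRiesz
  exact (Real.measurable_log.comp (by fun_prop)).mul (measurable_norm.pow_const _)

theorem measurable_logRieszQuotient (α β r : ℝ) (e : E) :
    Measurable (logRieszQuotient α β r e) :=
  ((measurable_logRiesz α r).sub_const _).div
    ((measurable_norm.comp (measurable_id.sub_const e)).pow_const _)

theorem measurable_inversionDefect (α β : ℝ) (e : E) : Measurable (inversionDefect α β e) :=
  (((measurable_norm.pow_const _).sub_const _).mul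
    (Real.measurable_log.comp measurable_norm).neg).div
    ((measurable_norm.comp (measurable_id.sub_const e)).pow_const _)

theorem measurableSet_lt_norm_sub (e : E) (ε : ℝ) : MeasurableSet {z : E | ε < ‖z - e‖} :=
  measurableSet_lt measurable_const (measurable_norm.comp (measurable_id.sub_const e))

variable [NormedSpace ℝ E] [FiniteDimensional ℝ E] [Nontrivial E] (μ : Measure E) [μ.IsAddHaarMeasure]

theorem integrableOn_logRieszQuotient {α β r ε : ℝ} (hα : 0 < α) (hαd : α < finrank ℝ E)
    (hβ : (finrank ℝ E : ℝ) < β) (hr : 0 < r) (hε : 0 < ε) (e : E) :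
    IntegrableOn (logRieszQuotient α β r e) {z | ε < ‖z - e‖} μ := by
  have hlog : 0 ≤ Real.log (1 + r) := Real.log_nonneg (by linarith)
  have hβ0 : 0 < β := lt_of_le_of_lt (Nat.cast_nonneg _) hβ
  have hfar : IntegrableOn (fun z : E => ‖z - e‖ ^ (-β)) {z | ε < ‖z - e‖} μ := by
    have h := integrableOn_norm_rpow_compl_ball (E := E) μ (a := -β) (by linarith) hε
    exact ((measurePreserving_sub_right μ e).integrableOn_comp_preimage
      (measurableEmbedding_subRight e)).2 h
  have hnear : Integrable ((ball (0 : E) 1).indicator fun z => ‖z‖ ^ (-α)) μ :=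
    (integrable_indicator_iff measurableSet_ball).2
      (integrableOn_ball_norm_rpow μ (by linarith) one_pos)
  refine ((hfar.const_mul ((1 + r) ^ α / α + Real.log (1 + r))).add
    (hnear.integrableOn.const_mul (Real.log (1 + r) * ε ^ (-β)))).mono'
    (measurable_logRieszQuotient α β r e).aestronglyMeasurable ?_
  refine (ae_restrict_iff' (measurableSet_lt_norm_sub e ε)).2 (ae_of_all _ fun z hz => ?_)
  have hz : ε < ‖z - e‖ := hz
  have hδ : 0 < ‖z - e‖ := hε.trans hz
  have hf0 := logRiesz_nonneg (α := α) hr z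
  have hA : 0 ≤ (1 + r) ^ α / α := by positivity
  have hf : logRiesz α r z ≤ (1 + r) ^ α / α +
      Real.log (1 + r) * (ball (0 : E) 1).indicator (fun z => ‖z‖ ^ (-α)) z := by
    by_cases h : ‖z‖ < 1
    · rw [indicator_of_mem (by simpa using h)]
      linarith [logRiesz_le_of_le_one (α := α) hr h.le]
    · rw [indicator_of_notMem (by simpa using h)]
      linarith [logRiesz_le_of_one_le hα hr (not_lt.1 h)]
  have hi : 0 ≤ (ball (0 : E) 1).indicator (fun z => ‖z‖ ^ (-α)) z :=
    indicator_nonneg (fun _ _ => by positivity) _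
  have hpow : ‖z - e‖ ^ (-β) ≤ ε ^ (-β) :=
    Real.rpow_le_rpow_of_nonpos hε hz.le (by linarith)
  have habs : |logRiesz α r z - Real.log (1 + r)| ≤ logRiesz α r z + Real.log (1 + r) :=
    abs_le.2 ⟨by linarith, by linarith⟩
  rw [logRieszQuotient, div_eq_mul_inv, ← Real.rpow_neg hδ.le, norm_mul, Real.norm_eq_abs,
    Real.norm_of_nonneg (by positivity : (0 : ℝ) ≤ ‖z - e‖ ^ (-β))]
  set I := (ball (0 : E) 1).indicator (fun z => ‖z‖ ^ (-α)) z
  calc |logRiesz α r z - Real.log (1 + r)| * ‖z - e‖ ^ (-β)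
      ≤ ((1 + r) ^ α / α + Real.log (1 + r) + Real.log (1 + r) * I) * ‖z - e‖ ^ (-β) := by
        gcongr; linarith
    _ = ((1 + r) ^ α / α + Real.log (1 + r)) * ‖z - e‖ ^ (-β) +
        Real.log (1 + r) * ‖z - e‖ ^ (-β) * I := by ring
    _ ≤ ((1 + r) ^ α / α + Real.log (1 + r)) * ‖z - e‖ ^ (-β) +
        Real.log (1 + r) * ε ^ (-β) * I := by gcongr

theorem exists_integral_inversionDefect_le {α β : ℝ} (hα : 0 < α) (hαd : α < finrank ℝ E)
    (hβ0 : 0 ≤ β) (hβ : β < finrank ℝ E + 2) :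
    ∃ C > 0, ∀ e : E, ‖e‖ = 1 → IntegrableOn (inversionDefect α β e) (ball 0 1) μ ∧
      ∫ w in ball (0 : E) 1, inversionDefect α β e w ∂μ ≤ C := by
  obtain ⟨a, ha0, ha⟩ : ∃ a, 0 < a ∧ α + a < finrank ℝ E :=
    ⟨(finrank ℝ E - α) / 2, by linarith, by linarith⟩
  set c₁ : ℝ := 2 ^ β / a
  set c₂ : ℝ := α * 2 ^ α * 4
  have hc₁ : 0 ≤ c₁ := by positivity
  have hc₂ : 0 ≤ c₂ := by positivity
  set I₁ := ∫ w in ball (0 : E) 1, ‖w‖ ^ (-(α + a)) ∂μ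
  set I₂ := ∫ w in ball (0 : E) 2, ‖w‖ ^ (2 - β) ∂μ
  have hI₁ : 0 ≤ I₁ := integral_nonneg fun w => by positivity
  have hI₂ : 0 ≤ I₂ := integral_nonneg fun w => by positivity
  refine ⟨c₁ * I₁ + c₂ * I₂ + 1, by positivity, fun e he => ?_⟩
  have hint₁ : IntegrableOn (fun w : E => ‖w‖ ^ (-(α + a))) (ball 0 1) μ :=
    integrableOn_ball_norm_rpow μ (by linarith) one_pos
  have hint₂ : IntegrableOn (fun w : E => ‖w‖ ^ (2 - β)) (ball 0 2) μ :=
    integrableOn_ball_norm_rpow μ (by linarith) two_pos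
  have hpre : (fun w : E => w - e) ⁻¹' ball 0 2 = ball e 2 := by
    ext w; simp [dist_eq_norm]
  have hint₃ : IntegrableOn (fun w : E => ‖w - e‖ ^ (2 - β)) (ball e 2) μ := by
    rw [← hpre]
    exact ((measurePreserving_sub_right μ e).integrableOn_comp_preimage
      (measurableEmbedding_subRight e)).2 hint₂
  have hI₃ : ∫ w in ball e 2, ‖w - e‖ ^ (2 - β) ∂μ = I₂ := by
    rw [← hpre]
    exact (measurePreserving_sub_right μ e).setIntegral_preimage_emb
      (measurableEmbedding_subRight e) (fun w => ‖w‖ ^ (2 - β)) _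
  have hsub : ball (0 : E) 1 ⊆ ball e 2 :=
    ball_subset_ball' (by rw [dist_eq_norm, zero_sub, norm_neg, he]; norm_num)
  have hae : ∀ᵐ w ∂μ.restrict (ball (0 : E) 1), w ∈ ball (0 : E) 1 ∧ w ≠ 0 :=
    (ae_restrict_mem measurableSet_ball).and (ae_restrict_of_ae (μ.ae_ne 0))
  have hdom : IntegrableOn (fun w : E => c₁ * ‖w‖ ^ (-(α + a)) + c₂ * ‖w - e‖ ^ (2 - β))
      (ball 0 1) μ := (hint₁.const_mul c₁).add ((hint₃.mono_set hsub).const_mul c₂)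
  have hle : ∀ᵐ w ∂μ.restrict (ball (0 : E) 1), inversionDefect α β e w ≤
      c₁ * ‖w‖ ^ (-(α + a)) + c₂ * ‖w - e‖ ^ (2 - β) := by
    filter_upwards [hae] with w hw
    exact inversionDefect_le hα.le hβ0 ha0 he hw.2 (by simpa using hw.1)
  have hint : IntegrableOn (inversionDefect α β e) (ball 0 1) μ := by
    refine hdom.mono' (measurable_inversionDefect α β e).aestronglyMeasurable ?_
    filter_upwards [hae, hle] with w hw h
    rwa [Real.norm_of_nonneg
      (inversionDefect_nonneg hα.le hw.2 (by simpa using (mem_ball_zero_iff.1 hw.1).le))]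
  refine ⟨hint, ?_⟩
  calc ∫ w in ball (0 : E) 1, inversionDefect α β e w ∂μ
      ≤ ∫ w in ball (0 : E) 1, (c₁ * ‖w‖ ^ (-(α + a)) + c₂ * ‖w - e‖ ^ (2 - β)) ∂μ :=
        integral_mono_ae hint hdom hle
    _ = c₁ * I₁ + c₂ * ∫ w in ball (0 : E) 1, ‖w - e‖ ^ (2 - β) ∂μ := by
        rw [integral_add (hint₁.const_mul c₁) ((hint₃.mono_set hsub).const_mul c₂),
          integral_const_mul, integral_const_mul]
    _ ≤ c₁ * I₁ + c₂ * I₂ := by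
        rw [← hI₃]
        have := setIntegral_mono_set hint₃ (ae_of_all _ fun w => by positivity)
          hsub.eventuallyLE
        gcongr
    _ ≤ c₁ * I₁ + c₂ * I₂ + 1 := by linarith

theorem measureReal_collar_le (e : E) {ε : ℝ} (hε : 0 < ε) (hε1 : ε ≤ 1) :
    μ.real (closedBall e ε \ ball e (ε * (1 - ε))) ≤
      finrank ℝ E * ε ^ (finrank ℝ E + 1) * μ.real (ball 0 1) := by
  rw [measureReal_sdiff (ball_subset_closedBall.trans (closedBall_subset_closedBall
    (mul_le_of_le_one_right hε.le (by linarith)))) measurableSet_ball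
    measure_closedBall_lt_top.ne, Measure.addHaar_real_closedBall _ _ hε.le,
    ← Measure.addHaar_real_closedBall_eq_addHaar_real_ball μ e, Measure.addHaar_real_closedBall _ _
      (mul_nonneg hε.le (by linarith)), ← sub_mul]
  gcongr
  have h := one_add_mul_le_pow (a := -ε) (by linarith) (finrank ℝ E)
  have hp : 0 < ε ^ finrank ℝ E := by positivity
  rw [mul_pow, pow_succ, sub_eq_add_neg 1 ε]
  nlinarith

end LogRiesz

section Inversion

variable {E : Type*} [NormedAddCommGroup E] [InnerProductSpace ℝ E]

open EuclideanGeometry in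
theorem inversion_image_punctured_ball {e : E} (he : ‖e‖ = 1) {ε : ℝ} :
    inversion (0 : E) 1 '' {w | w ≠ 0 ∧ ‖w‖ < 1 ∧ ε * ‖w‖ < ‖w - e‖} =
      {z | 1 < ‖z‖ ∧ ε < ‖z - e‖} := by
  have hiff : ∀ w : E, w ≠ 0 → ((1 < ‖inversion 0 1 w‖ ∧ ε < ‖inversion 0 1 w - e‖) ↔
      (‖w‖ < 1 ∧ ε * ‖w‖ < ‖w - e‖)) := fun w hw => by
    have hρ : 0 < ‖w‖ := norm_pos_iff.2 hw
    rw [norm_inversion_zero, norm_inversion_sub_of_norm_eq_one he hw, one_lt_inv₀ hρ,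
      lt_div_iff₀ hρ]
  ext z
  constructor
  · rintro ⟨w, ⟨hw, h⟩, rfl⟩
    exact (hiff w hw).2 h
  · intro hz
    have hz0 : z ≠ 0 := by rintro rfl; exact absurd hz.1 (by simp)
    have hw : inversion 0 1 z ≠ 0 := fun h => hz0 ((inversion_eq_center one_ne_zero).1 h)
    refine ⟨inversion 0 1 z, ⟨hw, (hiff _ hw).1 ?_⟩, inversion_inversion _ one_ne_zero _⟩
    rwa [inversion_inversion _ one_ne_zero]

/-- The pullback of `logRieszQuotient` under inversion in the unit sphere, Jacobian included. -/
theorem jacobian_mul_logRieszQuotient_inversion {α β r : ℝ} {d : ℕ} (hsum : α + β = 2 * d)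
    {e w : E} (he : ‖e‖ = 1) (hw : w ≠ 0) :
    ((1 / ‖w‖) ^ 2) ^ d * logRieszQuotient α β r e (EuclideanGeometry.inversion 0 1 w) =
      (Real.log (1 + r * ‖w‖⁻¹) - Real.log (1 + r) * ‖w‖ ^ (-α)) / ‖w - e‖ ^ β := by
  have hρ : 0 < ‖w‖ := norm_pos_iff.2 hw
  have hpow : ((1 / ‖w‖) ^ 2) ^ d = ‖w‖ ^ (-α) * (‖w‖ ^ β)⁻¹ := by
    rw [← Real.rpow_neg hρ.le, ← Real.rpow_add hρ, ← pow_mul, one_div, inv_pow,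
      ← Real.rpow_natCast, ← Real.rpow_neg hρ.le]
    congr 1
    push_cast
    linarith
  rw [logRieszQuotient, logRiesz, norm_inversion_zero, norm_inversion_sub_of_norm_eq_one he hw,
    Real.div_rpow (norm_nonneg _) hρ.le, hpow, Real.inv_rpow hρ.le, Real.rpow_neg hρ.le]
  have h1 : ‖w‖ ^ α ≠ 0 := (Real.rpow_pos_of_pos hρ _).ne'
  have h2 : ‖w‖ ^ β ≠ 0 := (Real.rpow_pos_of_pos hρ _).ne'
  field_simp

variable [FiniteDimensional ℝ E] [Nontrivial E] [MeasurableSpace E] [BorelSpace E]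
  (μ : Measure E) [μ.IsAddHaarMeasure]

/-- Folding the exterior of the unit ball onto its interior by inversion bounds the truncated
principal value from below, up to the mismatch of the two truncations. -/
theorem neg_le_setIntegral_logRieszQuotient {α β C : ℝ} (hα : 0 < α) (hαd : α < finrank ℝ E)
    (hsum : α + β = 2 * finrank ℝ E) {e : E} (he : ‖e‖ = 1)
    (hint : IntegrableOn (inversionDefect α β e) (ball 0 1) μ)
    (hC : ∫ w in ball (0 : E) 1, inversionDefect α β e w ∂μ ≤ C) {r : ℝ} (hr : 0 < r) :
    ∃ K, ∀ ε, 0 < ε → ε ≤ 1 / 2 → -C - K * ε ^ (finrank ℝ E + 2 - β) ≤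
      ∫ z in {z | ε < ‖z - e‖}, logRieszQuotient α β r e z ∂μ := by
  set d := finrank ℝ E
  set G := logRieszQuotient α β r e
  set L := Real.log (1 + r)
  have hL : 0 ≤ L := Real.log_nonneg (by linarith)
  set c : ℝ := α * 2 ^ α * 2
  have hc : 0 ≤ c := by positivity
  have hβ : (d : ℝ) < β := by linarith
  have hβ0 : 0 < β := lt_of_le_of_lt (Nat.cast_nonneg _) hβ
  set v := μ.real (ball (0 : E) 1)
  refine ⟨L * c * 2 ^ β * (d * v), fun ε hε hε2 => ?_⟩
  set H : E → ℝ := fun w =>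
    (Real.log (1 + r * ‖w‖⁻¹) - L * ‖w‖ ^ (-α)) / ‖w - e‖ ^ β
  set A : Set E := {w | w ≠ 0 ∧ ‖w‖ < 1 ∧ ε < ‖w - e‖}
  set B : Set E := {w | w ≠ 0 ∧ ‖w‖ < 1 ∧ ε * ‖w‖ < ‖w - e‖}
  set O : Set E := {z | 1 < ‖z‖ ∧ ε < ‖z - e‖}
  have hdist : Measurable fun w : E => ‖w - e‖ := measurable_norm.comp (measurable_id.sub_const e)
  have hmA : MeasurableSet A := (measurableSet_singleton 0).compl.inter
    ((measurableSet_lt measurable_norm measurable_const).inter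
      (measurableSet_lt measurable_const hdist))
  have hmB : MeasurableSet B := (measurableSet_singleton 0).compl.inter
    ((measurableSet_lt measurable_norm measurable_const).inter
      (measurableSet_lt (measurable_norm.const_mul ε) hdist))
  have hmO : MeasurableSet O := (measurableSet_lt measurable_const measurable_norm).inter
      (measurableSet_lt measurable_const hdist)
  have hAB : A ⊆ B := fun w hw =>
    ⟨hw.1, hw.2.1, (mul_le_of_le_one_right hε.le hw.2.1.le).trans_lt hw.2.2⟩
  have hG : IntegrableOn G {z | ε < ‖z - e‖} μ :=
    integrableOn_logRieszQuotient μ hα hαd hβ hr hε e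
  have hGA : IntegrableOn G A μ := hG.mono_set fun w hw => hw.2.2
  have hGO : IntegrableOn G O μ := hG.mono_set fun w hw => hw.2
  have hsplit : ∫ z in {z | ε < ‖z - e‖}, G z ∂μ = ∫ z in A, G z ∂μ + ∫ z in O, G z ∂μ := by
    rw [← setIntegral_union (disjoint_left.2 fun w hA hO => lt_asymm hA.2.1 hO.1) hmO hGA hGO]
    refine setIntegral_congr_set ?_
    have hsphere : ∀ᵐ w ∂μ, w ∉ sphere (0 : E) 1 :=
      measure_eq_zero_iff_ae_notMem.1 (Measure.addHaar_sphere μ 0 1)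
    filter_upwards [μ.ae_ne 0, hsphere] with w hw0 hw1
    refine propext ⟨fun h => ?_, fun h => h.elim (fun h => h.2.2) fun h => h.2⟩
    rcases lt_trichotomy ‖w‖ 1 with h1 | h1 | h1
    · exact Or.inl ⟨hw0, h1, h⟩
    · exact absurd (by simpa using h1) hw1
    · exact Or.inr ⟨h1, h⟩
  have hderiv : ∀ w ∈ B, HasFDerivWithinAt (EuclideanGeometry.inversion (0 : E) 1)
      ((1 / ‖w‖) ^ 2 • ((ℝ ∙ w)ᗮ.reflection : E →L[ℝ] E)) B w := fun w hw => by
    simpa using (EuclideanGeometry.hasFDerivAt_inversion (c := 0) (R := 1) hw.1).hasFDerivWithinAt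
  have hinj : InjOn (EuclideanGeometry.inversion (0 : E) 1) B :=
    (EuclideanGeometry.inversion_injective 0 one_ne_zero).injOn
  have hpull : ∀ w ∈ B, |((1 / ‖w‖) ^ 2 • ((ℝ ∙ w)ᗮ.reflection : E →L[ℝ] E)).det| •
      G (EuclideanGeometry.inversion 0 1 w) = H w := fun w hw => by
    rw [abs_det_smul_reflection _ (by positivity), smul_eq_mul]
    exact jacobian_mul_logRieszQuotient_inversion hsum he hw.1
  have himage : EuclideanGeometry.inversion (0 : E) 1 '' B = O :=
    inversion_image_punctured_ball he
  have hO : ∫ z in O, G z ∂μ = ∫ w in B, H w ∂μ := by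
    rw [← himage, integral_image_eq_integral_abs_det_fderiv_smul μ hmB hderiv hinj]
    exact setIntegral_congr_fun hmB hpull
  have hHB : IntegrableOn H B μ := by
    rw [← himage, integrableOn_image_iff_integrableOn_abs_det_fderiv_smul μ hmB hderiv hinj] at hGO
    exact hGO.congr_fun hpull hmB
  have hHA : IntegrableOn H A μ := hHB.mono_set hAB
  have hAball : A ⊆ ball 0 1 := fun w hw => by simpa using hw.2.1
  have hfold : -C ≤ ∫ w in A, G w ∂μ + ∫ w in A, H w ∂μ := by
    rw [← integral_add hGA hHA]
    have h1 : ∫ w in A, inversionDefect α β e w ∂μ ≤ C := by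
      refine (setIntegral_mono_set hint ?_ hAball.eventuallyLE).trans hC
      filter_upwards [ae_restrict_mem measurableSet_ball, ae_restrict_of_ae (μ.ae_ne 0)]
        with w hw hw0
      exact inversionDefect_nonneg hα.le hw0 (by simpa using (mem_ball_zero_iff.1 hw).le)
    have h2 : ∫ w in A, -inversionDefect α β e w ∂μ ≤ ∫ w in A, (G w + H w) ∂μ := by
      refine setIntegral_mono_on (hint.mono_set hAball).neg (hGA.add hHA) hmA fun w hw => ?_
      have := neg_defect_le_log_increments hα.le hr (norm_pos_iff.2 hw.1) hw.2.1.le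
      simp only [G, H, inversionDefect, logRieszQuotient, logRiesz]
      rw [← neg_div, ← add_div]
      gcongr
    rw [integral_neg] at h2
    linarith
  have hcollar : B \ A ⊆ closedBall e ε \ ball e (ε * (1 - ε)) := by
    rintro w ⟨⟨hw0, hw1, hw2⟩, hwA⟩
    have hle : ‖w - e‖ ≤ ε := not_lt.1 fun h => hwA ⟨hw0, hw1, h⟩
    have hge := one_sub_norm_le (w := w) he
    refine ⟨by simpa [dist_eq_norm] using hle, ?_⟩
    rw [mem_ball, dist_eq_norm, not_lt]
    nlinarith
  have hfin : μ (closedBall e ε \ ball e (ε * (1 - ε))) ≠ ⊤ :=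
    ((measure_mono sdiff_subset).trans_lt measure_closedBall_lt_top).ne
  have hvol : μ.real (B \ A) ≤ d * ε ^ (d + 1) * v :=
    (measureReal_mono hcollar hfin).trans (measureReal_collar_le μ e hε (by linarith))
  have hrest : -(L * c * 2 ^ β * (d * v) * ε ^ (d + 2 - β)) ≤ ∫ w in B \ A, H w ∂μ := by
    set κ := L * (c * ε) * (2 ^ β * ε ^ (-β))
    have hκ : 0 ≤ κ := by positivity
    have hlow : ∀ w ∈ B \ A, -κ ≤ H w := by
      rintro w ⟨⟨hw0, hw1, hw2⟩, hwA⟩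
      have hle : ‖w - e‖ ≤ ε := not_lt.1 fun h => hwA ⟨hw0, hw1, h⟩
      have hge := one_sub_norm_le (w := w) he
      have hρ : 1 / 2 ≤ ‖w‖ := by linarith
      have hδ : ε / 2 ≤ ‖w - e‖ := by nlinarith
      have hδ0 : 0 < ‖w - e‖ := by linarith
      have hp : ‖w‖ ^ (-α) - 1 ≤ c * ε :=
        (rpow_neg_sub_one_le hα.le hρ hw1.le).trans (by gcongr; linarith)
      have hlog : L ≤ Real.log (1 + r * ‖w‖⁻¹) := by
        refine Real.log_le_log (by linarith) ?_
        have : 1 ≤ ‖w‖⁻¹ := (one_le_inv₀ (by linarith)).2 hw1.le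
        nlinarith
      have hinv : (‖w - e‖ ^ β)⁻¹ ≤ 2 ^ β * ε ^ (-β) := by
        rw [Real.rpow_neg hε.le, ← Real.inv_rpow hε.le, ← Real.inv_rpow hδ0.le,
          ← Real.mul_rpow two_pos.le (by positivity)]
        refine Real.rpow_le_rpow (by positivity) ?_ hβ0.le
        rw [inv_le_comm₀ hδ0 (by positivity), mul_inv, inv_inv]
        linarith
      have hnum : -(L * (c * ε)) ≤ Real.log (1 + r * ‖w‖⁻¹) - L * ‖w‖ ^ (-α) := by nlinarith
      calc -κ = -(L * (c * ε)) * (2 ^ β * ε ^ (-β)) := by ring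
        _ ≤ -(L * (c * ε)) * (‖w - e‖ ^ β)⁻¹ :=
          mul_le_mul_of_nonpos_left hinv (neg_nonpos.2 (by positivity))
        _ ≤ (Real.log (1 + r * ‖w‖⁻¹) - L * ‖w‖ ^ (-α)) * (‖w - e‖ ^ β)⁻¹ := by gcongr
        _ = H w := (div_eq_mul_inv _ _).symm
    have h1 : ∫ _ in B \ A, -κ ∂μ ≤ ∫ w in B \ A, H w ∂μ :=
      setIntegral_mono_on (integrableOn_const (measure_ne_top_of_subset hcollar hfin)) (hHB.mono_set sdiff_subset)
        (hmB.diff hmA) hlow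
    rw [setIntegral_const, smul_eq_mul] at h1
    have h2 : μ.real (B \ A) * κ ≤ d * ε ^ (d + 1) * v * κ := by gcongr
    have h3 : d * ε ^ (d + 1) * v * κ = L * c * 2 ^ β * (d * v) * ε ^ (d + 2 - β) := by
      have : ε ^ ((d : ℝ) + 2 - β) = ε ^ (d + 1) * ε * ε ^ (-β) := by
        rw [← pow_succ, ← Real.rpow_natCast, ← Real.rpow_add hε]
        congr 1
        push_cast
        ring
      rw [this]
      ring
    linarith
  have hdiff := setIntegral_sdiff hmA hHB hAB
  rw [hsplit, hO]
  linarith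

end Inversion

section SecondDifference

variable {E : Type*} [NormedAddCommGroup E] [MeasurableSpace E] [BorelSpace E]

theorem setIntegral_second_difference [SecondCountableTopology E] (μ : Measure E)
    [μ.IsAddLeftInvariant] [μ.IsNegInvariant] {α β r ε : ℝ} {e : E} (he : ‖e‖ = 1)
    (hG : IntegrableOn (logRieszQuotient α β r e) {z | ε < ‖z - e‖} μ) :
    ∫ y in {y : E | ε < ‖y‖},
        (logRiesz α r (e + y) + logRiesz α r (e - y) - 2 * logRiesz α r e) / ‖y‖ ^ β ∂μ =
      2 * ∫ z in {z | ε < ‖z - e‖}, logRieszQuotient α β r e z ∂μ := by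
  have hval : logRiesz α r e = Real.log (1 + r) := by simp [logRiesz, he]
  have hadd : (fun y : E => e + y) ⁻¹' {z | ε < ‖z - e‖} = {y | ε < ‖y‖} := by ext y; simp
  have hsub : (fun y : E => e - y) ⁻¹' {z | ε < ‖z - e‖} = {y | ε < ‖y‖} := by ext y; simp
  have eadd := measurableEmbedding_addLeft e
  have esub := (MeasurableEquiv.subLeft e).measurableEmbedding
  have madd := measurePreserving_add_left μ e
  have msub := Measure.measurePreserving_sub_left μ e
  have iadd := (madd.integrableOn_comp_preimage eadd).2 hG
  have isub := (msub.integrableOn_comp_preimage esub).2 hG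
  have vadd := madd.setIntegral_preimage_emb eadd (logRieszQuotient α β r e) {z | ε < ‖z - e‖}
  have vsub := msub.setIntegral_preimage_emb esub (logRieszQuotient α β r e) {z | ε < ‖z - e‖}
  rw [hadd] at iadd vadd
  rw [hsub] at isub vsub
  refine Eq.trans ?_ ((integral_add iadd isub).trans ((congrArg₂ _ vadd vsub).trans
    (two_mul _).symm))
  refine integral_congr_ae (ae_of_all _ fun y => ?_)
  simp only [logRieszQuotient, Function.comp_apply, add_sub_cancel_left, sub_sub_cancel_left,
    norm_neg, hval]
  ring

theorem tendsto_setIntegral_lt_norm (μ : Measure E) [NullSingletonClass μ] {h : E → ℝ}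
    (hh : Integrable h μ) :
    Tendsto (fun k : ℕ => ∫ y in {y : E | 1 / ((k : ℝ) + 2) < ‖y‖}, h y ∂μ) atTop
      (𝓝 (∫ y, h y ∂μ)) := by
  have hunion : ⋃ k : ℕ, {y : E | 1 / ((k : ℝ) + 2) < ‖y‖} = {0}ᶜ := by
    ext y
    simp only [mem_iUnion, mem_ofPred_eq, mem_compl_iff, mem_singleton_iff]
    refine ⟨?_, fun hy => ?_⟩
    · rintro ⟨k, hk⟩ rfl
      rw [norm_zero] at hk
      exact absurd hk (not_lt.2 (by positivity))
    · obtain ⟨k, hk⟩ := exists_nat_one_div_lt (norm_pos_iff.2 hy)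
      exact ⟨k, lt_of_le_of_lt (by gcongr; norm_num) hk⟩
  have hmono : Monotone fun k : ℕ => {y : E | 1 / ((k : ℝ) + 2) < ‖y‖} := by
    intro k l hkl y hy
    have hy : 1 / ((k : ℝ) + 2) < ‖y‖ := hy
    exact lt_of_le_of_lt (by gcongr) hy
  have hlim := tendsto_setIntegral_of_monotone (μ := μ) (f := h)
    (s := fun k : ℕ => {y : E | 1 / ((k : ℝ) + 2) < ‖y‖})
    (fun k => measurableSet_lt measurable_const measurable_norm)
    hmono hh.integrableOn
  rwa [hunion, restrict_compl_singleton] at hlim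

end SecondDifference

theorem exists_neg_le_integral_second_difference {E : Type*} [NormedAddCommGroup E]
    [InnerProductSpace ℝ E] [FiniteDimensional ℝ E] [Nontrivial E] [MeasurableSpace E]
    [BorelSpace E] (μ : Measure E) [μ.IsAddHaarMeasure] {α β : ℝ} (hα : 0 < α)
    (hαd : α < finrank ℝ E) (hβ : β < finrank ℝ E + 2) (hsum : α + β = 2 * finrank ℝ E) :
    ∃ C > 0, ∀ r > 0, ∀ e : E, ‖e‖ = 1 → -C ≤ ∫ y,
      (logRiesz α r (e + y) + logRiesz α r (e - y) - 2 * logRiesz α r e) / ‖y‖ ^ β ∂μ := by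
  have hdβ : (finrank ℝ E : ℝ) < β := by linarith
  obtain ⟨C, hC, hCe⟩ := exists_integral_inversionDefect_le μ hα hαd
    (lt_of_le_of_lt (Nat.cast_nonneg _) hdβ).le hβ
  refine ⟨2 * C, by positivity, fun r hr e he => ?_⟩
  by_cases hh : Integrable (fun y : E =>
    (logRiesz α r (e + y) + logRiesz α r (e - y) - 2 * logRiesz α r e) / ‖y‖ ^ β) μ
  swap
  · rw [integral_undef hh]
    linarith
  obtain ⟨hint, hle⟩ := hCe e he
  obtain ⟨K, hK⟩ := neg_le_setIntegral_logRieszQuotient μ hα hαd hsum he hint hle hr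
  have hε : Tendsto (fun k : ℕ => 1 / ((k : ℝ) + 2)) atTop (𝓝 0) := by
    have := (tendsto_one_div_add_atTop_nhds_zero_nat (𝕜 := ℝ)).comp (tendsto_add_atTop_nat 1)
    refine this.congr fun k => ?_
    simp only [Function.comp_apply]
    push_cast
    ring
  have herr : Tendsto (fun k : ℕ => 2 * (-C - K * (1 / ((k : ℝ) + 2)) ^ (finrank ℝ E + 2 - β)))
      atTop (𝓝 (-(2 * C))) := by
    have h0 := hε.rpow_const (p := finrank ℝ E + 2 - β) (Or.inr (by linarith))
    rw [Real.zero_rpow (by linarith)] at h0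
    have := ((h0.const_mul K).const_sub (-C)).const_mul 2
    convert this using 2
    ring
  refine le_of_tendsto_of_tendsto' herr (tendsto_setIntegral_lt_norm μ hh) fun k => ?_
  have hk : (0 : ℝ) < 1 / ((k : ℝ) + 2) := by positivity
  rw [setIntegral_second_difference μ he
    (integrableOn_logRieszQuotient μ hα hαd hdβ hr hk e)]
  gcongr
  exact hK _ hk (by gcongr; linarith [(Nat.cast_nonneg k : (0 : ℝ) ≤ k)])

theorem logRiesz_one_smul {E : Type*} [NormedAddCommGroup E] [NormedSpace ℝ E] {α R : ℝ}
    (hR : 0 < R) (z : E) : logRiesz α 1 (R • z) = R ^ (-α) * logRiesz α R z := by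
  rw [logRiesz, logRiesz, norm_smul, Real.norm_of_nonneg hR.le, one_mul,
    Real.mul_rpow hR.le (norm_nonneg z)]
  ring

theorem fracLap_logRiesz_smul {n : ℕ} {s R : ℝ} (hR : 0 < R) (e : EuclideanSpace ℝ (Fin n)) :
    fracLap n s (logRiesz (n - 2 * s) 1) (R • e) =
      R ^ (-(n : ℝ)) * fracLap n s (logRiesz (n - 2 * s) R) e := by
  set α : ℝ := n - 2 * s with hα
  set β : ℝ := n + 2 * s with hβ
  have h := Measure.integral_comp_smul volume (fun y : EuclideanSpace ℝ (Fin n) =>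
    (logRiesz α 1 (R • e + y) + logRiesz α 1 (R • e - y) - 2 * logRiesz α 1 (R • e)) /
      ‖y‖ ^ β) R
  have hpt : ∀ y : EuclideanSpace ℝ (Fin n),
      (logRiesz α 1 (R • e + R • y) + logRiesz α 1 (R • e - R • y) -
        2 * logRiesz α 1 (R • e)) / ‖R • y‖ ^ β =
      R ^ (-α - β) * ((logRiesz α R (e + y) + logRiesz α R (e - y) - 2 * logRiesz α R e) /
        ‖y‖ ^ β) := fun y => by
    rw [← smul_add, ← smul_sub, logRiesz_one_smul hR, logRiesz_one_smul hR, logRiesz_one_smul hR,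
      norm_smul, Real.norm_of_nonneg hR.le, Real.mul_rpow hR.le (norm_nonneg y),
      Real.rpow_sub hR]
    have := (Real.rpow_pos_of_pos hR β).ne'
    field_simp
  simp only [hpt] at h
  rw [integral_const_mul, finrank_euclideanSpace_fin, abs_of_pos (by positivity), smul_eq_mul,
    eq_inv_mul_iff_mul_eq₀ (by positivity), ← mul_assoc, ← Real.rpow_natCast,
    ← Real.rpow_add hR] at h
  have hexp : (n : ℝ) + (-α - β) = -n := by rw [hα, hβ]; ring
  rw [hexp] at h
  rw [fracLap, fracLap, ← h]
  ring

/-- for Θ(x) = log(1+|x|)|x|^(−n+2s), one has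
(−Δ)^s Θ (x) ≤ C₀ |x|^(−n) for all x ≠ 0 (Lemma 2.3). -/
theorem stmt_12 (n : ℕ) (s : ℝ) (hn : 2 ≤ n) (hs : 0 < s) (hs1 : s < 1)
    (hns : 2 * s < (n : ℝ)) :
    ∃ C₀ > 0, ∀ x : EuclideanSpace ℝ (Fin n), x ≠ 0 →
      fracLap n s (fun y => Real.log (1 + ‖y‖) * ‖y‖ ^ (-(n : ℝ) + 2 * s)) x
        ≤ C₀ * ‖x‖ ^ (-(n : ℝ)) := by
  have : Nonempty (Fin n) := ⟨⟨0, by omega⟩⟩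
  obtain ⟨C, hC, hCe⟩ := exists_neg_le_integral_second_difference
    (volume : Measure (EuclideanSpace ℝ (Fin n))) (α := n - 2 * s) (β := n + 2 * s)
    (by linarith) (by rw [finrank_euclideanSpace_fin]; linarith)
    (by rw [finrank_euclideanSpace_fin]; linarith) (by rw [finrank_euclideanSpace_fin]; ring)
  refine ⟨C, hC, fun x hx => ?_⟩
  have hR : 0 < ‖x‖ := norm_pos_iff.2 hx
  have hprofile : (fun y : EuclideanSpace ℝ (Fin n) =>
      Real.log (1 + ‖y‖) * ‖y‖ ^ (-(n : ℝ) + 2 * s)) = logRiesz (n - 2 * s) 1 := by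
    funext y
    rw [logRiesz, one_mul, neg_sub, sub_eq_neg_add]
  have hunit : ‖‖x‖⁻¹ • x‖ = 1 := norm_smul_inv_norm (𝕜 := ℝ) hx
  have hxe : x = ‖x‖ • ‖x‖⁻¹ • x := (smul_inv_smul₀ hR.ne' x).symm
  have hbound := hCe ‖x‖ hR _ hunit
  rw [hprofile]
  nth_rewrite 1 [hxe]
  rw [fracLap_logRiesz_smul hR, mul_comm C]
  gcongr
  rw [fracLap]
  linarith
end
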